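/- arXiv:1805.04480 — 2 statements merged into one kernel-verified Lean document; each statement's English description precedes it below -/
import Mathlib

section
/- Let ξ be a Liouville number, i.e. for every positive integer m there exist integers p, b with b ≥ 2 and 0 < |ξ − p/b| < b^{−m}, and set ξ₁ = ξ and ξ₂ = ξ². Then φ̄₃ = 1 and φ̲₃ = 0. -/
open Filter Pointwise

/-- The lattice `Λ = {(x, ξ₁x - y₁, ξ₂x - y₂) : x, y₁, y₂ ∈ ℤ} ⊆ ℝ³`. -/
def LatticeSet (ξ₁ ξ₂ : ℝ) : Set (Fin 3 → ℝ) :=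
  {p | ∃ x y₁ y₂ : ℤ, p 0 = (x : ℝ) ∧ p 1 = ξ₁ * x - y₁ ∧ p 2 = ξ₂ * x - y₂}

/-- The box `K(q) = {(z₀,z₁,z₂) : |z₀| ≤ e^{2q}, |z₁| ≤ e^{-q}, |z₂| ≤ e^{-q}}`. -/
def Box (q : ℝ) : Set (Fin 3 → ℝ) :=
  {z | |z 0| ≤ Real.exp (2 * q) ∧ |z 1| ≤ Real.exp (-q) ∧ |z 2| ≤ Real.exp (-q)}

/-- The `j`-th successive minimum `λ_j(q)` of `K(q)` with respect to `Λ`: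
the infimum of all `λ > 0` such that `λ·K(q)` contains `j` linearly independent
points of `Λ`. -/
noncomputable def lambdaMin (ξ₁ ξ₂ : ℝ) (j : ℕ) (q : ℝ) : ℝ :=
  sInf {l : ℝ | 0 < l ∧ ∃ v : Fin j → (Fin 3 → ℝ), LinearIndependent ℝ v ∧
    ∀ i, v i ∈ LatticeSet ξ₁ ξ₂ ∧ v i ∈ l • Box q}

/-- `L_j(q) = log λ_j(q)`. -/
noncomputable def Lmin (ξ₁ ξ₂ : ℝ) (j : ℕ) (q : ℝ) : ℝ :=
  Real.log (lambdaMin ξ₁ ξ₂ j q)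

/-- `φ̲_j = liminf_{q → ∞} L_j(q)/q`. -/
noncomputable def phiLow (ξ₁ ξ₂ : ℝ) (j : ℕ) : ℝ :=
  liminf (fun q : ℝ => Lmin ξ₁ ξ₂ j q / q) atTop

/-- `φ̄_j = limsup_{q → ∞} L_j(q)/q`. -/
noncomputable def phiUp (ξ₁ ξ₂ : ℝ) (j : ℕ) : ℝ :=
  limsup (fun q : ℝ => Lmin ξ₁ ξ₂ j q / q) atTop

section SuccessiveMinima

variable {ξ₁ ξ₂ ξ l q : ℝ} {j : ℕ}

lemma mem_smul_Box_iff (hl : 0 < l) {z : Fin 3 → ℝ} :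
    z ∈ l • Box q ↔ |z 0| ≤ l * Real.exp (2 * q) ∧ |z 1| ≤ l * Real.exp (-q) ∧
      |z 2| ≤ l * Real.exp (-q) := by
  rw [Set.mem_smul_set_iff_inv_smul_mem₀ hl.ne']
  simp only [Box, Set.mem_ofPred_eq, Pi.smul_apply, smul_eq_mul, abs_mul, abs_inv, abs_of_pos hl,
    inv_mul_le_iff₀ hl]

lemma linearIndependent_iff_det_of_ne_zero {v : Fin 3 → Fin 3 → ℝ} :
    LinearIndependent ℝ v ↔ (Matrix.of v).det ≠ 0 := by
  rw [← isUnit_iff_ne_zero, ← Matrix.isUnit_iff_isUnit_det]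
  exact Matrix.linearIndependent_rows_iff_isUnit (A := Matrix.of v)

lemma lambdaMin_le (hl : 0 < l) {v : Fin j → Fin 3 → ℝ} (hv : LinearIndependent ℝ v)
    (h : ∀ i, v i ∈ LatticeSet ξ₁ ξ₂ ∧ v i ∈ l • Box q) : lambdaMin ξ₁ ξ₂ j q ≤ l :=
  csInf_le ⟨0, fun _ hx => hx.1.le⟩ ⟨hl, v, hv, h⟩

lemma exists_basis_mem_exp_smul_Box (hq : 0 ≤ q) :
    ∃ v : Fin 3 → Fin 3 → ℝ, LinearIndependent ℝ v ∧
      ∀ i, v i ∈ LatticeSet ξ₁ ξ₂ ∧ v i ∈ Real.exp q • Box q := by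
  refine ⟨![![1, Int.fract ξ₁, Int.fract ξ₂], ![0, 1, 0], ![0, 0, 1]], ?_, fun i => ?_⟩
  · rw [linearIndependent_iff_det_of_ne_zero]
    simp [Matrix.det_fin_three]
  have hmul : Real.exp q * Real.exp (-q) = 1 := by rw [← Real.exp_add]; simp
  have h3 : 1 ≤ Real.exp q * Real.exp (2 * q) := by
    rw [← Real.exp_add]; exact Real.one_le_exp (by linarith)
  rw [mem_smul_Box_iff (Real.exp_pos q), hmul]
  fin_cases i
  · refine ⟨⟨1, ⌊ξ₁⌋, ⌊ξ₂⌋, ?_⟩, ?_⟩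
    · simp [Int.self_sub_floor]
    · simp [abs_of_nonneg, Int.fract_nonneg, (Int.fract_lt_one _).le, h3]
  · exact ⟨⟨0, -1, 0, by simp⟩, by simpa using by positivity⟩
  · exact ⟨⟨0, 0, -1, by simp⟩, by simpa using by positivity⟩

lemma lambdaMin_three_le_exp (hq : 0 ≤ q) : lambdaMin ξ₁ ξ₂ 3 q ≤ Real.exp q := by
  obtain ⟨v, hv, h⟩ := exists_basis_mem_exp_smul_Box (ξ₁ := ξ₁) (ξ₂ := ξ₂) hq
  exact lambdaMin_le (Real.exp_pos q) hv h

lemma le_lambdaMin_three {c : ℝ} (hq : 0 ≤ q)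
    (h : ∀ l : ℝ, 0 < l → ∀ v : Fin 3 → Fin 3 → ℝ, LinearIndependent ℝ v →
      (∀ i, v i ∈ LatticeSet ξ₁ ξ₂ ∧ v i ∈ l • Box q) → c ≤ l) :
    c ≤ lambdaMin ξ₁ ξ₂ 3 q :=
  le_csInf ⟨_, Real.exp_pos q, exists_basis_mem_exp_smul_Box hq⟩
    fun l ⟨hl, v, hv, hm⟩ => h l hl v hv hm

lemma exists_det_eq_intCast {v : Fin 3 → Fin 3 → ℝ} (h : ∀ i, v i ∈ LatticeSet ξ₁ ξ₂) :
    ∃ d : ℤ, (Matrix.of v).det = d := by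
  choose x y z hx hy hz using h
  refine ⟨Matrix.det (Matrix.of fun i => ![x i, y i, z i]), ?_⟩
  simp only [Matrix.det_fin_three, Matrix.of_apply, hx, hy, hz]
  simp
  ring

lemma abs_det_fin_three_le {M : Matrix (Fin 3) (Fin 3) ℝ} {a b c : ℝ}
    (h0 : ∀ i, |M i 0| ≤ a) (h1 : ∀ i, |M i 1| ≤ b) (h2 : ∀ i, |M i 2| ≤ c) :
    |M.det| ≤ 6 * (a * b * c) := by
  have ha : 0 ≤ a := (abs_nonneg _).trans (h0 0)
  have hb : 0 ≤ b := (abs_nonneg _).trans (h1 0)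
  have key (i j k : Fin 3) : |M i 0 * M j 1 * M k 2| ≤ a * b * c := by
    rw [abs_mul, abs_mul]
    gcongr
    exacts [h0 i, h1 j, h2 k]
  have e : M.det = M 0 0 * M 1 1 * M 2 2 - M 0 0 * M 2 1 * M 1 2 - M 1 0 * M 0 1 * M 2 2
      + M 2 0 * M 0 1 * M 1 2 + M 1 0 * M 2 1 * M 0 2 - M 2 0 * M 1 1 * M 0 2 := by
    rw [Matrix.det_fin_three]; ring
  have k1 := abs_le.1 (key 0 1 2)
  have k2 := abs_le.1 (key 0 2 1)
  have k3 := abs_le.1 (key 1 0 2)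
  have k4 := abs_le.1 (key 2 0 1)
  have k5 := abs_le.1 (key 1 2 0)
  have k6 := abs_le.1 (key 2 1 0)
  rw [e, abs_le]
  constructor <;> linarith [k1.1, k1.2, k2.1, k2.2, k3.1, k3.2, k4.1, k4.2, k5.1, k5.2, k6.1, k6.2]

lemma one_sixth_le_lambdaMin_three (hq : 0 ≤ q) : 1 / 6 ≤ lambdaMin ξ₁ ξ₂ 3 q := by
  refine le_lambdaMin_three hq fun l hl v hv hm => ?_
  obtain ⟨d, hd⟩ := exists_det_eq_intCast fun i => (hm i).1
  rw [linearIndependent_iff_det_of_ne_zero, hd, Int.cast_ne_zero] at hv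
  have hbox i := (mem_smul_Box_iff hl).1 (hm i).2
  have hle := abs_det_fin_three_le (M := Matrix.of v) (fun i => (hbox i).1)
    (fun i => (hbox i).2.1) (fun i => (hbox i).2.2)
  have he : Real.exp (2 * q) * Real.exp (-q) * Real.exp (-q) = 1 := by
    rw [← Real.exp_add, ← Real.exp_add]; ring_nf; simp
  have h1 : (1 : ℝ) ≤ |(d : ℝ)| := by exact_mod_cast Int.one_le_abs hv
  have h6 : 1 ≤ 6 * l ^ 3 := by
    rw [hd] at hle
    calc (1 : ℝ) ≤ _ := h1.trans hle
      _ = 6 * l ^ 3 * (Real.exp (2 * q) * Real.exp (-q) * Real.exp (-q)) := by ring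
      _ = _ := by rw [he, mul_one]
  by_contra! hlt
  have : l ^ 3 < (1 / 6) ^ 3 := by gcongr
  linarith

lemma lambdaMin_three_pos (hq : 0 ≤ q) : 0 < lambdaMin ξ₁ ξ₂ 3 q :=
  lt_of_lt_of_le (by norm_num) (one_sixth_le_lambdaMin_three hq)

lemma Lmin_three_div_le_one (hq : 0 < q) : Lmin ξ₁ ξ₂ 3 q / q ≤ 1 := by
  rw [div_le_one hq]
  exact (Real.log_le_iff_le_exp (lambdaMin_three_pos hq.le)).2 (lambdaMin_three_le_exp hq.le)

lemma eventually_neg_le_Lmin_three_div {ε : ℝ} (hε : 0 < ε) :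
    ∀ᶠ q : ℝ in atTop, -ε ≤ Lmin ξ₁ ξ₂ 3 q / q := by
  filter_upwards [eventually_gt_atTop 0, eventually_ge_atTop (Real.log 6 / ε)] with q hq hq'
  have h := Real.log_le_log (by norm_num) (one_sixth_le_lambdaMin_three (ξ₁ := ξ₁) (ξ₂ := ξ₂) hq.le)
  rw [one_div, Real.log_inv] at h
  rw [le_div_iff₀ hq]
  rw [div_le_iff₀ hε] at hq'
  unfold Lmin
  linarith

/-- A good rational approximation `r` of `ξ₁` confines the lattice points of a suitable box to
a plane, which makes the third minimum large. -/
lemma pow_den_le_lambdaMin_three {r : ℚ} {k : ℕ} (hr : 2 ≤ r.den)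
    (h : |ξ₁ - r| < 1 / (r.den : ℝ) ^ (3 * (k + 2))) :
    (r.den : ℝ) ^ k ≤ lambdaMin ξ₁ ξ₂ 3 ((k + 2 : ℕ) * Real.log r.den) := by
  have hn2 : (2 : ℝ) ≤ r.den := by exact_mod_cast hr
  have hn0 : (0 : ℝ) < r.den := by linarith
  have hexp : Real.exp ((k + 2 : ℕ) * Real.log r.den) = (r.den : ℝ) ^ (k + 2) := by
    rw [Real.exp_nat_mul, Real.exp_log hn0]
  have hq : 0 ≤ (k + 2 : ℕ) * Real.log r.den :=
    mul_nonneg (Nat.cast_nonneg _) (Real.log_nonneg (by linarith))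
  refine le_lambdaMin_three hq fun l hl v hv hm => ?_
  generalize ((k + 2 : ℕ) : ℝ) * Real.log r.den = q at hexp hm
  rw [linearIndependent_iff_det_of_ne_zero] at hv
  by_contra! hlt
  refine hv (Matrix.exists_mulVec_eq_zero_iff.1 ⟨![r.num - r.den * ξ₁, r.den, 0], ?_, ?_⟩)
  · exact fun h0 => hn0.ne' (by simpa using congrFun h0 1)
  ext i
  obtain ⟨⟨x, y₁, y₂, hx, hy, -⟩, hb⟩ := hm i
  obtain ⟨hb0, hb1, -⟩ := (mem_smul_Box_iff hl).1 hb
  rw [Real.exp_neg, hexp] at hb1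
  rw [two_mul, Real.exp_add, hexp] at hb0
  have hrat : (r : ℝ) = r.num / r.den := by exact_mod_cast (Rat.num_div_den r).symm
  have hform : (r.num - r.den * ξ₁) * v i 0 + r.den * v i 1 =
      ((r.num * x - r.den * y₁ : ℤ) : ℝ) := by
    rw [hx, hy]; push_cast; ring
  have hfirst : |(r.num - r.den * ξ₁) * v i 0| < 1 / 2 := by
    have e : (r.num : ℝ) - r.den * ξ₁ = -(r.den * (ξ₁ - r)) := by rw [hrat]; field_simp; ring
    rw [e, abs_mul, abs_neg, abs_mul, abs_of_pos hn0]
    calc r.den * |ξ₁ - r| * |v i 0|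
        ≤ r.den * (1 / (r.den : ℝ) ^ (3 * (k + 2))) *
          (l * ((r.den : ℝ) ^ (k + 2) * (r.den : ℝ) ^ (k + 2))) := by gcongr
      _ < r.den * (1 / (r.den : ℝ) ^ (3 * (k + 2))) *
          ((r.den : ℝ) ^ k * ((r.den : ℝ) ^ (k + 2) * (r.den : ℝ) ^ (k + 2))) := by gcongr
      _ = 1 / r.den := by field_simp; ring
      _ ≤ 1 / 2 := by gcongr
  have hsecond : |r.den * v i 1| < 1 / 2 := by
    rw [abs_mul, abs_of_pos hn0]
    calc r.den * |v i 1| ≤ r.den * (l * ((r.den : ℝ) ^ (k + 2))⁻¹) := by gcongr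
      _ < r.den * ((r.den : ℝ) ^ k * ((r.den : ℝ) ^ (k + 2))⁻¹) := by gcongr
      _ = 1 / r.den := by field_simp; ring
      _ ≤ 1 / 2 := by gcongr
  have hzero : r.num * x - r.den * y₁ = 0 := by
    rw [← Int.abs_lt_one_iff]
    have : |((r.num * x - r.den * y₁ : ℤ) : ℝ)| < 1 := by
      rw [← hform]
      exact (abs_add_le _ _).trans_lt (by linarith)
    exact_mod_cast this
  rw [hzero, Int.cast_zero] at hform
  simp only [Matrix.mulVec, dotProduct, Fin.sum_univ_three, Matrix.of_apply]
  simp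
  linarith

/-- Points close to the rational line through `(n ^ 2, n * a, a ^ 2)`, completing it to a
unimodular system. -/
lemma exists_unimodular_completion {a n : ℤ} (hn : 0 < n) (h : IsCoprime a n) :
    ∃ k s x y z : ℤ, 0 ≤ k ∧ k < n ∧ k * a ^ 2 - n * s = 1 ∧ 0 ≤ x ∧ x < n + n ^ 2 ∧
      x * a - n * y = 1 ∧ 0 ≤ x * a ^ 2 - z * n ^ 2 ∧ x * a ^ 2 - z * n ^ 2 < n := by
  have reduce {c : ℤ} (hc : IsCoprime c n) (w : ℤ) : ∃ k s : ℤ, 0 ≤ k ∧ k < n ∧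
      k * c - n * s = w := by
    obtain ⟨u, v, huv⟩ := hc
    refine ⟨(w * u) % n, -(w * v + (w * u) / n * c), Int.emod_nonneg _ hn.ne',
      Int.emod_lt_of_pos _ hn, ?_⟩
    linear_combination w * huv + c * Int.emod_add_mul_ediv (w * u) n
  obtain ⟨k, s, hk0, hkn, hks⟩ := reduce (h.pow_left (m := 2)) 1
  obtain ⟨u, v, hu0, hun, huv⟩ := reduce h 1
  obtain ⟨t, w, ht0, htn, htw⟩ := reduce (h.pow_left (m := 2)) (-(u * a ^ 2 / n))
  have hr : (u + n * t) * a ^ 2 - w * n ^ 2 = (u * a ^ 2) % n := by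
    linear_combination n * htw - Int.emod_add_mul_ediv (u * a ^ 2) n
  refine ⟨k, s, u + n * t, v + a * t, w, hk0, hkn, hks, by positivity, by nlinarith,
    by linear_combination huv, ?_, ?_⟩
  · rw [hr]; exact Int.emod_nonneg _ hn.ne'
  · rw [hr]; exact Int.emod_lt_of_pos _ hn

lemma lambdaMin_three_log_den_le {r : ℚ} (h : |ξ - r| < 1 / (r.den : ℝ) ^ 3) :
    lambdaMin ξ (ξ ^ 2) 3 (Real.log r.den) ≤ 4 * |ξ| + 3 := by
  have hnpos : 0 < r.den := r.den_pos
  have hn1 : (1 : ℝ) ≤ r.den := by exact_mod_cast hnpos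
  have hn0 : (0 : ℝ) < r.den := by linarith
  have hcop : IsCoprime r.num (r.den : ℤ) := by
    rw [Int.isCoprime_iff_gcd_eq_one]
    exact r.reduced
  obtain ⟨k, s, x, y, z, hk0, hkn, hks, hx0, hxn, hxy, hz0, hzn⟩ :=
    exists_unimodular_completion (by exact_mod_cast hnpos) hcop
  have hrat : (r : ℝ) = r.num / r.den := by exact_mod_cast (Rat.num_div_den r).symm
  have hexp : Real.exp (Real.log r.den) = r.den := Real.exp_log hn0
  have hξ := abs_nonneg ξ
  have hD : 0 < 4 * |ξ| + 3 := by positivity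
  -- The box condition for an integer point follows from that of its rational approximation.
  have hbox (x y z : ℤ) (hx : |(x : ℝ)| ≤ 2 * (r.den : ℝ) ^ 2) (hy : |x * (r : ℝ) - y| ≤ 1 / r.den)
      (hz : |x * (r : ℝ) ^ 2 - z| ≤ 1 / r.den) :
      ![(x : ℝ), ξ * x - y, ξ ^ 2 * x - z] ∈ LatticeSet ξ (ξ ^ 2) ∧
        ![(x : ℝ), ξ * x - y, ξ ^ 2 * x - z] ∈ (4 * |ξ| + 3) • Box (Real.log r.den) := by
    refine ⟨⟨x, y, z, by simp⟩, ?_⟩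
    rw [mem_smul_Box_iff hD, two_mul, Real.exp_add, Real.exp_neg, hexp]
    have hxξ : |(x : ℝ)| * |ξ - r| ≤ 2 / r.den := by
      calc |(x : ℝ)| * |ξ - r| ≤ 2 * (r.den : ℝ) ^ 2 * (1 / (r.den : ℝ) ^ 3) := by gcongr
        _ = 2 / r.den := by field_simp
    have hsum : |ξ + r| ≤ 2 * |ξ| + 1 := by
      have h1 : 1 / (r.den : ℝ) ^ 3 ≤ 1 := by
        rw [div_le_one (by positivity)]; exact one_le_pow₀ hn1
      calc |ξ + r| = |2 * ξ - (ξ - r)| := by ring_nf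
        _ ≤ |2 * ξ| + |ξ - r| := abs_sub _ _
        _ ≤ _ := by rw [abs_mul, abs_two]; linarith
    refine ⟨?_, ?_, ?_⟩
    · calc |(x : ℝ)| ≤ 2 * (r.den : ℝ) ^ 2 := hx
        _ ≤ (4 * |ξ| + 3) * (r.den : ℝ) ^ 2 := by gcongr; linarith
        _ = _ := by ring
    · calc |ξ * x - y| = |x * (ξ - r) + (x * (r : ℝ) - y)| := by ring_nf
        _ ≤ |(x : ℝ)| * |ξ - r| + |x * (r : ℝ) - y| := by rw [← abs_mul]; exact abs_add_le _ _
        _ ≤ 2 / r.den + 1 / r.den := add_le_add hxξ hy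
        _ = 3 * (r.den : ℝ)⁻¹ := by ring
        _ ≤ _ := by gcongr; linarith
    · calc |ξ ^ 2 * x - z| = |x * (ξ - r) * (ξ + r) + (x * (r : ℝ) ^ 2 - z)| := by ring_nf
        _ ≤ |(x : ℝ)| * |ξ - r| * |ξ + r| + |x * (r : ℝ) ^ 2 - z| := by
          rw [← abs_mul, ← abs_mul]; exact abs_add_le _ _
        _ ≤ 2 / r.den * (2 * |ξ| + 1) + 1 / r.den := by gcongr
        _ = _ := by ring
  refine lambdaMin_le hD
    (v := ![![((r.den ^ 2 : ℤ) : ℝ), ξ * (r.den ^ 2 : ℤ) - (r.den * r.num : ℤ),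
        ξ ^ 2 * (r.den ^ 2 : ℤ) - (r.num ^ 2 : ℤ)],
      ![((r.den * k : ℤ) : ℝ), ξ * (r.den * k : ℤ) - (r.num * k : ℤ),
        ξ ^ 2 * (r.den * k : ℤ) - s],
      ![(x : ℝ), ξ * x - y, ξ ^ 2 * x - z]]) ?_ fun i => ?_
  · rw [linearIndependent_iff_det_of_ne_zero]
    have hks' : (k : ℝ) * r.num ^ 2 - r.den * s = 1 := by exact_mod_cast hks
    have hxy' : (x : ℝ) * r.num - r.den * y = 1 := by exact_mod_cast hxy
    refine ne_of_eq_of_ne (b := -1) ?_ (by norm_num)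
    rw [Matrix.det_fin_three]
    simp
    linear_combination -((k : ℝ) * r.num ^ 2 - r.den * s) * hxy' - hks'
  · fin_cases i
    · refine hbox _ _ _ ?_ ?_ ?_
      · push_cast; rw [abs_of_nonneg (by positivity)]; nlinarith
      · rw [hrat]; push_cast; field_simp; simp
      · rw [hrat]; push_cast; field_simp; simp
    · have hk0' : (0 : ℝ) ≤ k := by exact_mod_cast hk0
      have hkn' : (k : ℝ) ≤ r.den := by exact_mod_cast hkn.le
      have hks' : (k : ℝ) * r.num ^ 2 - r.den * s = 1 := by exact_mod_cast hks
      refine hbox _ _ _ ?_ ?_ ?_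
      · push_cast; rw [abs_of_nonneg (by positivity)]; nlinarith
      · have e : ((r.den * k : ℤ) : ℝ) * r - (r.num * k : ℤ) = 0 := by
          rw [hrat]; push_cast; field_simp; ring
        rw [e, abs_zero]; positivity
      · have e : ((r.den * k : ℤ) : ℝ) * (r : ℝ) ^ 2 - s = 1 / r.den := by
          rw [hrat]; push_cast; field_simp; linear_combination hks'
        rw [e, abs_of_nonneg (by positivity)]
    · have hx0' : (0 : ℝ) ≤ x := by exact_mod_cast hx0
      have hxn' : (x : ℝ) ≤ r.den + r.den ^ 2 := by exact_mod_cast hxn.le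
      have hxy' : (x : ℝ) * r.num - r.den * y = 1 := by exact_mod_cast hxy
      have hz0' : (0 : ℝ) ≤ x * r.num ^ 2 - z * r.den ^ 2 := by exact_mod_cast hz0
      have hzn' : (x : ℝ) * r.num ^ 2 - z * r.den ^ 2 ≤ r.den := by exact_mod_cast hzn.le
      refine hbox _ _ _ ?_ ?_ ?_
      · rw [abs_of_nonneg hx0']; nlinarith
      · have e : (x : ℝ) * r - y = 1 / r.den := by
          rw [hrat]; field_simp; linear_combination hxy'
        rw [e, abs_of_nonneg (by positivity)]
      · have e : (x : ℝ) * (r : ℝ) ^ 2 - z = (x * r.num ^ 2 - z * r.den ^ 2) / r.den ^ 2 := by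
          rw [hrat]; field_simp
        rw [e, abs_of_nonneg (by positivity), div_le_div_iff₀ (by positivity) hn0]
        nlinarith

end SuccessiveMinima

lemma Liouville.exists_rat_lt_den {ξ : ℝ} (hξ : Liouville ξ) (N m : ℕ) :
    ∃ r : ℚ, N < r.den ∧ |ξ - r| < 1 / (r.den : ℝ) ^ m := by
  obtain ⟨ε, hε, hpos⟩ := ((hξ.irrational.eventually_forall_le_dist_cast_rat_of_den_le N).filter_mono
    nhdsWithin_le_nhds |>.and (self_mem_nhdsWithin (s := Set.Ioi (0 : ℝ)))).exists
  obtain ⟨M, hM⟩ := exists_pow_lt_of_lt_one hpos (by norm_num : (1 / 2 : ℝ) < 1)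
  obtain ⟨a, b, hb, -, hab⟩ := hξ (max m M)
  have hb2 : (2 : ℝ) ≤ b := by exact_mod_cast hb
  have hcast : ((a / b : ℚ) : ℝ) = a / b := by push_cast; rfl
  have hden : (((a / b : ℚ).den : ℤ)) ≤ b := Int.le_of_dvd (by lia) (by simpa [Rat.divInt_eq_div] using Rat.den_dvd a b)
  have hdenR : ((a / b : ℚ).den : ℝ) ≤ b := by exact_mod_cast hden
  have hden0 : (0 : ℝ) < (a / b : ℚ).den := by exact_mod_cast (a / b : ℚ).den_pos
  refine ⟨a / b, ?_, ?_⟩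
  · by_contra! hle
    have h1 := hε _ hle
    rw [hcast, Real.dist_eq] at h1
    have h2 : 1 / (b : ℝ) ^ max m M ≤ (1 / 2) ^ M := by
      rw [one_div_pow]
      gcongr
      calc (2 : ℝ) ^ M ≤ 2 ^ max m M := by gcongr; norm_num; exact le_max_right _ _
        _ ≤ _ := by gcongr
    linarith
  · rw [hcast]
    refine hab.trans_le ?_
    gcongr
    calc ((a / b : ℚ).den : ℝ) ^ m ≤ (b : ℝ) ^ m := by gcongr
      _ ≤ _ := by gcongr; linarith; exact le_max_left _ _

lemma Liouville.frequently_le_Lmin_three_div {ξ₁ ξ₂ ε : ℝ} (hξ : Liouville ξ₁) (hε : 0 < ε) :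
    ∃ᶠ q : ℝ in atTop, 1 - ε ≤ Lmin ξ₁ ξ₂ 3 q / q := by
  rw [frequently_atTop]
  intro Q
  obtain ⟨k, hk⟩ := exists_nat_gt (2 / ε)
  obtain ⟨N, hN⟩ := exists_nat_gt (Real.exp Q)
  obtain ⟨r, hrN, hr⟩ := hξ.exists_rat_lt_den (max N 1) (3 * (k + 2))
  have hr2 : 2 ≤ r.den := by have := le_max_right N 1; lia
  have hrR : (2 : ℝ) ≤ r.den := by exact_mod_cast hr2
  have hlog : 0 < Real.log r.den := Real.log_pos (by linarith)
  have hQ : Q ≤ Real.log r.den := by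
    rw [Real.le_log_iff_exp_le (by linarith)]
    have : (N : ℝ) ≤ r.den := by exact_mod_cast (le_max_left N 1).trans hrN.le
    linarith
  refine ⟨(k + 2 : ℕ) * Real.log r.den, ?_, ?_⟩
  · have : (0 : ℝ) ≤ k := k.cast_nonneg
    push_cast
    nlinarith
  · have h := Real.log_le_log (by positivity) (pow_den_le_lambdaMin_three (ξ₂ := ξ₂) hr2 hr)
    rw [Real.log_pow] at h
    rw [le_div_iff₀ (by positivity)]
    refine le_trans ?_ h
    rw [← mul_assoc]
    gcongr
    rw [div_lt_iff₀ hε] at hk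
    push_cast
    nlinarith

lemma Liouville.frequently_Lmin_three_div_le {ξ ε : ℝ} (hξ : Liouville ξ) (hε : 0 < ε) :
    ∃ᶠ q : ℝ in atTop, Lmin ξ (ξ ^ 2) 3 q / q ≤ ε := by
  rw [frequently_atTop]
  intro Q
  obtain ⟨N, hN⟩ := exists_nat_gt (Real.exp (max Q (Real.log (4 * |ξ| + 3) / ε)))
  obtain ⟨r, hrN, hr⟩ := hξ.exists_rat_lt_den (max N 1) 3
  have hrR : (1 : ℝ) < r.den := by exact_mod_cast (le_max_right N 1).trans_lt hrN
  have hlog : 0 < Real.log r.den := Real.log_pos hrR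
  have hQ : max Q (Real.log (4 * |ξ| + 3) / ε) ≤ Real.log r.den := by
    rw [Real.le_log_iff_exp_le (by linarith)]
    have : (N : ℝ) ≤ r.den := by exact_mod_cast (le_max_left N 1).trans hrN.le
    linarith
  refine ⟨Real.log r.den, (le_max_left _ _).trans hQ, ?_⟩
  have h := Real.log_le_log (lambdaMin_three_pos hlog.le) (lambdaMin_three_log_den_le hr)
  have hQ' := (le_max_right _ _).trans hQ
  rw [div_le_iff₀ hε] at hQ'
  rw [div_le_iff₀ hlog]
  unfold Lmin
  linarith

/-- If `ξ` is a Liouville number (for every positive integer `m` there are integers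
`p, b` with `b ≥ 2` and `0 < |ξ - p/b| < b^{-m}`), then the pair `(ξ, ξ²)` satisfies
`φ̄₃ = 1` and `φ̲₃ = 0`. -/
theorem phi_three_of_liouville_pair
    (ξ : ℝ)
    (hliou : ∀ m : ℕ, 0 < m → ∃ p b : ℤ, 2 ≤ b ∧
      0 < |ξ - (p : ℝ) / b| ∧ |ξ - (p : ℝ) / b| < (b : ℝ) ^ (-(m : ℤ))) :
    phiUp ξ (ξ ^ 2) 3 = 1 ∧ phiLow ξ (ξ ^ 2) 3 = 0 := by

  have hξ : Liouville ξ := fun n => by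
    obtain ⟨p, b, hb, h0, h⟩ := hliou (n + 1) n.succ_pos
    have hb1 : (1 : ℝ) ≤ b := by exact_mod_cast (by lia : (1 : ℤ) ≤ b)
    refine ⟨p, b, by lia, sub_ne_zero.1 (abs_pos.1 h0), h.trans_le ?_⟩
    rw [zpow_neg, zpow_natCast, ← one_div]
    gcongr
    exact n.le_succ
  have hle : ∀ᶠ q : ℝ in atTop, Lmin ξ (ξ ^ 2) 3 q / q ≤ 1 := by
    filter_upwards [eventually_gt_atTop 0] with q hq using Lmin_three_div_le_one hq
  have hge {ε : ℝ} (hε : 0 < ε) : ∀ᶠ q : ℝ in atTop, -ε ≤ Lmin ξ (ξ ^ 2) 3 q / q :=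
    eventually_neg_le_Lmin_three_div hε
  have hbdd : IsBoundedUnder (· ≤ ·) atTop fun q : ℝ => Lmin ξ (ξ ^ 2) 3 q / q := ⟨1, hle⟩
  have hbdd' : IsBoundedUnder (· ≥ ·) atTop fun q : ℝ => Lmin ξ (ξ ^ 2) 3 q / q :=
    ⟨-1, hge one_pos⟩
  refine ⟨le_antisymm (limsup_le_of_le hbdd'.isCoboundedUnder_le hle) ?_, le_antisymm ?_ ?_⟩
  · refine le_of_forall_sub_le fun ε hε => ?_
    exact le_limsup_of_frequently_le (hξ.frequently_le_Lmin_three_div hε) hbdd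
  · refine le_of_forall_pos_le_add fun ε hε => ?_
    rw [zero_add]
    exact liminf_le_of_frequently_le (hξ.frequently_Lmin_three_div_le hε) hbdd'
  · refine le_of_forall_sub_le fun ε hε => ?_
    rw [zero_sub]
    exact le_liminf_of_le hbdd.isCoboundedUnder_ge (hge hε)
end

section
/- Let ξ₁, ξ₂ be real numbers such that {1, ξ₁, ξ₂} is linearly independent over ℚ and suppose 0 ≤ φ̲₃ < 1. Then φ̄₂ ≤ (φ̄₁ − φ̲₁)/(2 − φ̄₁ − φ̄₁·φ̲₁) and φ̲₂ ≥ (φ̲₃ − φ̄₃)/(2 − φ̲₃ − φ̄₃·φ̲₃). -/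
open Filter Pointwise

namespace SchmidtSummerer

open Matrix

section

/-- The point with integer coordinate vector `n` in the lattice generated by the columns
of `P`. -/
def embed (P : Matrix (Fin 3) (Fin 3) ℝ) (n : Fin 3 → ℤ) : Fin 3 → ℝ :=
  P *ᵥ fun i => (n i : ℝ)

/-- The half side lengths of the box `Box t`. -/
noncomputable def weight (t : ℝ) : Fin 3 → ℝ :=
  ![Real.exp (2 * t), Real.exp (-t), Real.exp (-t)]

/-- The norm whose unit ball is `Box t`. -/
noncomputable def boxNorm (t : ℝ) (v : Fin 3 → ℝ) : ℝ :=
  max (|v 0| * Real.exp (-2 * t)) (max |v 1| |v 2| * Real.exp t)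

/-- `n` is a nonzero vector at which `boxNorm t` attains its minimum on the nonzero lattice
points. -/
def IsMinimalPoint (P : Matrix (Fin 3) (Fin 3) ℝ) (t : ℝ) (n : Fin 3 → ℤ) : Prop :=
  n ≠ 0 ∧ ∀ m, m ≠ 0 → boxNorm t (embed P n) ≤ boxNorm t (embed P m)

lemma weight_pos (t : ℝ) (i : Fin 3) : 0 < weight t i := by
  fin_cases i <;> simp [weight, Real.exp_pos]

lemma weight_prod (t : ℝ) : weight t 0 * weight t 1 * weight t 2 = 1 := by
  simp only [weight, Matrix.cons_val]
  rw [← Real.exp_add, ← Real.exp_add]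
  ring_nf
  simp

lemma boxNorm_le_iff {t l : ℝ} {v : Fin 3 → ℝ} :
    boxNorm t v ≤ l ↔ ∀ i, |v i| ≤ l * weight t i := by
  have h2 : Real.exp (-2 * t) = (Real.exp (2 * t))⁻¹ := by rw [← Real.exp_neg]; ring_nf
  have h1 : Real.exp t = (Real.exp (-t))⁻¹ := by rw [← Real.exp_neg]; ring_nf
  simp only [boxNorm, weight, Fin.forall_fin_succ, Matrix.cons_val]
  rw [h2, h1, ← div_eq_mul_inv, ← div_eq_mul_inv, max_le_iff, div_le_iff₀ (Real.exp_pos _),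
    div_le_iff₀ (Real.exp_pos _), max_le_iff]
  simp

lemma boxNorm_lt_iff {t l : ℝ} {v : Fin 3 → ℝ} :
    boxNorm t v < l ↔ ∀ i, |v i| < l * weight t i := by
  have h2 : Real.exp (-2 * t) = (Real.exp (2 * t))⁻¹ := by rw [← Real.exp_neg]; ring_nf
  have h1 : Real.exp t = (Real.exp (-t))⁻¹ := by rw [← Real.exp_neg]; ring_nf
  simp only [boxNorm, weight, Fin.forall_fin_succ, Matrix.cons_val]
  rw [h2, h1, ← div_eq_mul_inv, ← div_eq_mul_inv, max_lt_iff, div_lt_iff₀ (Real.exp_pos _),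
    div_lt_iff₀ (Real.exp_pos _), max_lt_iff]
  simp

lemma abs_apply_le (t : ℝ) (v : Fin 3 → ℝ) (i : Fin 3) : |v i| ≤ boxNorm t v * weight t i :=
  boxNorm_le_iff.1 le_rfl i

lemma exists_abs_eq (t : ℝ) (v : Fin 3 → ℝ) : ∃ i, |v i| = boxNorm t v * weight t i := by
  by_contra! h
  exact lt_irrefl _ (boxNorm_lt_iff.2 fun i => lt_of_le_of_ne (abs_apply_le t v i) (h i))

lemma boxNorm_nonneg (t : ℝ) (v : Fin 3 → ℝ) : 0 ≤ boxNorm t v :=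
  le_max_of_le_left (by positivity)

lemma boxNorm_pos {t : ℝ} {v : Fin 3 → ℝ} (hv : v ≠ 0) : 0 < boxNorm t v := by
  by_contra! h
  refine hv (funext fun i => abs_nonpos_iff.1 ?_)
  simpa using boxNorm_le_iff.1 h i

lemma boxNorm_smul (t c : ℝ) (v : Fin 3 → ℝ) : boxNorm t (c • v) = |c| * boxNorm t v := by
  simp only [boxNorm, Pi.smul_apply, smul_eq_mul, abs_mul]
  rw [mul_max_of_nonneg _ _ (abs_nonneg c), ← mul_assoc, ← mul_assoc,
    mul_max_of_nonneg _ _ (abs_nonneg c)]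

lemma boxNorm_le_mul_exp {s t : ℝ} (hst : s ≤ t) (v : Fin 3 → ℝ) :
    boxNorm t v ≤ boxNorm s v * Real.exp (t - s) := by
  refine max_le ?_ ?_
  · calc |v 0| * Real.exp (-2 * t) ≤ |v 0| * Real.exp (-2 * s) * Real.exp (t - s) := by
          rw [mul_assoc, ← Real.exp_add]
          gcongr
          linarith
      _ ≤ _ := mul_le_mul_of_nonneg_right (le_max_left _ _) (Real.exp_pos _).le
  · calc max |v 1| |v 2| * Real.exp t = max |v 1| |v 2| * Real.exp s * Real.exp (t - s) := by
          rw [mul_assoc, ← Real.exp_add]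
          ring_nf
      _ ≤ _ := mul_le_mul_of_nonneg_right (le_max_right _ _) (Real.exp_pos _).le

variable {P : Matrix (Fin 3) (Fin 3) ℝ}

lemma embed_ne_zero (hP : P.det = 1) {n : Fin 3 → ℤ} (hn : n ≠ 0) : embed P n ≠ 0 := by
  intro h
  have := Matrix.eq_zero_of_mulVec_eq_zero (by rw [hP]; exact one_ne_zero) h
  exact hn (funext fun i => by simpa using congrFun this i)

lemma finite_setOf_embed_le (hP : P.det = 1) (K : ℝ) :
    {n : Fin 3 → ℤ | ∀ i, |embed P n i| ≤ K}.Finite := by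
  obtain ⟨C, hC⟩ : ∃ C : ℝ, ∀ i j, |P⁻¹ i j| ≤ C := by
    obtain ⟨C, hC⟩ := (Set.finite_range fun p : Fin 3 × Fin 3 => |P⁻¹ p.1 p.2|).bddAbove
    exact ⟨C, fun i j => hC ⟨(i, j), rfl⟩⟩
  have hC0 : 0 ≤ C := (abs_nonneg _).trans (hC 0 0)
  refine (Set.finite_Icc (fun _ : Fin 3 => -⌈3 * (C * K)⌉) fun _ => ⌈3 * (C * K)⌉).subset ?_
  intro n hn
  have key : ∀ i, |(n i : ℝ)| ≤ 3 * (C * K) := by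
    intro i
    have h1 : P⁻¹ *ᵥ embed P n = fun i => (n i : ℝ) := by
      rw [embed, Matrix.mulVec_mulVec, Matrix.nonsing_inv_mul _ (by simp [hP]), Matrix.one_mulVec]
    rw [← congrFun h1 i]
    calc |(P⁻¹ *ᵥ embed P n) i| ≤ ∑ j, |P⁻¹ i j * embed P n j| := by
          simp only [Matrix.mulVec, dotProduct]
          exact Finset.abs_sum_le_sum_abs _ _
      _ ≤ ∑ _j : Fin 3, C * K := by
          refine Finset.sum_le_sum fun j _ => ?_
          rw [abs_mul]
          exact mul_le_mul (hC i j) (hn j) (abs_nonneg _) hC0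
      _ = 3 * (C * K) := by simp
  refine ⟨fun i => ?_, fun i => ?_⟩
  · have := (abs_le.1 (key i)).1
    have h2 := Int.le_ceil (3 * (C * K))
    exact_mod_cast (by push_cast; linarith : ((-⌈3 * (C * K)⌉ : ℤ) : ℝ) ≤ n i)
  · exact_mod_cast ((abs_le.1 (key i)).2.trans (Int.le_ceil _))

/-- Minkowski's theorem on linear forms. -/
lemma exists_embed_lt (hP : P.det = 1) (a : Fin 3 → ℝ) (ha : ∀ i, 0 < a i)
    (hprod : 1 < a 0 * a 1 * a 2) : ∃ n : Fin 3 → ℤ, n ≠ 0 ∧ ∀ i, |embed P n i| < a i := by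
  set S : Set (Fin 3 → ℝ) := Matrix.toLin' P ⁻¹' Set.univ.pi fun i => Set.Ioo (-a i) (a i)
    with hS
  have hfund := ZSpan.isAddFundamentalDomain (Pi.basisFun ℝ (Fin 3)) MeasureTheory.volume
  have hvol : MeasureTheory.volume S = ENNReal.ofReal (8 * (a 0 * a 1 * a 2)) := by
    rw [hS, MeasureTheory.Measure.addHaar_preimage_linearMap _ (by simp [hP]), Real.volume_pi_Ioo]
    rw [Fin.prod_univ_three, ← ENNReal.ofReal_mul, ← ENNReal.ofReal_mul, ← ENNReal.ofReal_mul]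
    · congr 1
      simp [hP]
      ring
    · positivity
    · have := ha 0; have := ha 1
      apply mul_nonneg <;> linarith
    · have := ha 0
      linarith
  have hF : MeasureTheory.volume (ZSpan.fundamentalDomain (Pi.basisFun ℝ (Fin 3))) = 1 := by
    rw [ZSpan.fundamentalDomain_pi_basisFun, Real.volume_pi_Ico]
    simp
  have hc : Countable (Submodule.span ℤ (Set.range (Pi.basisFun ℝ (Fin 3)))).toAddSubgroup := by
    change Countable (Submodule.span ℤ (Set.range (Pi.basisFun ℝ (Fin 3))))
    infer_instance
  have hsymm : ∀ x ∈ S, -x ∈ S := by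
    intro x hx i hi
    have := hx i hi
    simp only [map_neg, Pi.neg_apply, Set.mem_Ioo] at this ⊢
    constructor <;> linarith [this.1, this.2]
  have hconv : Convex ℝ S :=
    (convex_pi fun i _ => convex_Ioo _ _).linear_preimage (Matrix.toLin' P)
  have hlt : MeasureTheory.volume (ZSpan.fundamentalDomain (Pi.basisFun ℝ (Fin 3))) *
      2 ^ Module.finrank ℝ (Fin 3 → ℝ) < MeasureTheory.volume S := by
    rw [hF, hvol, one_mul, Module.finrank_fin_fun, ← ENNReal.ofReal_ofNat,
      ← ENNReal.ofReal_pow (by norm_num), ENNReal.ofReal_lt_ofReal_iff (by positivity)]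
    linarith
  obtain ⟨⟨x, hx⟩, hx0, hxS⟩ :=
    MeasureTheory.exists_ne_zero_mem_lattice_of_measure_mul_two_pow_lt_measure
      (L := (Submodule.span ℤ (Set.range (Pi.basisFun ℝ (Fin 3)))).toAddSubgroup)
      (s := S) hfund hsymm hconv hlt
  have hx' := (Module.Basis.mem_span_iff_repr_mem ℤ (Pi.basisFun ℝ (Fin 3)) x).1 hx
  choose n hn using hx'
  have hxn : x = fun i => (n i : ℝ) := by
    ext i
    simpa using (hn i).symm
  refine ⟨n, ?_, fun i => ?_⟩
  · rintro rfl
    exact hx0 (Subtype.ext (hxn.trans (funext fun i => by simp)))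
  · have := hxS i (Set.mem_univ i)
    subst hxn
    exact abs_lt.2 this

lemma exists_isMinimalPoint (hP : P.det = 1) (t : ℝ) : ∃ n, IsMinimalPoint P t n := by
  have hw := weight_pos t
  obtain ⟨n₀, hn₀, hb⟩ := exists_embed_lt hP (fun i => 2 * weight t i)
    (fun i => mul_pos two_pos (hw i)) (by
      have := weight_prod t
      nlinarith)
  set S : Set (Fin 3 → ℤ) := {n | n ≠ 0 ∧ boxNorm t (embed P n) ≤ 2} with hS
  have hfin : S.Finite := by
    refine (finite_setOf_embed_le hP (2 * (weight t 0 + weight t 1 + weight t 2))).subset ?_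
    rintro n ⟨-, hn⟩ i
    refine (boxNorm_le_iff.1 hn i).trans ?_
    have h0 := hw 0; have h1 := hw 1; have h2 := hw 2
    fin_cases i <;> simp <;> linarith
  have hn₀S : n₀ ∈ S := ⟨hn₀, boxNorm_le_iff.2 fun i => (hb i).le⟩
  obtain ⟨n, hn, hmin⟩ := Set.exists_min_image S (fun n => boxNorm t (embed P n)) hfin ⟨n₀, hn₀S⟩
  refine ⟨n, hn.1, fun m hm => ?_⟩
  by_cases h : boxNorm t (embed P m) ≤ 2
  · exact hmin m ⟨hm, h⟩
  · exact hn.2.trans (not_le.1 h).le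

namespace IsMinimalPoint

variable {t : ℝ} {x : Fin 3 → ℤ}

lemma pos (hP : P.det = 1) (hx : IsMinimalPoint P t x) : 0 < boxNorm t (embed P x) :=
  boxNorm_pos (embed_ne_zero hP hx.1)

lemma boxNorm_le_one (hP : P.det = 1) (hx : IsMinimalPoint P t x) :
    boxNorm t (embed P x) ≤ 1 := by
  by_contra! h
  set l := boxNorm t (embed P x)
  have hw := weight_pos t
  obtain ⟨n, hn, hb⟩ := exists_embed_lt hP (fun i => l * weight t i)
    (fun i => mul_pos (by linarith) (hw i)) (by
      have h1 := weight_prod t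
      have h2 : 1 < l ^ 3 := one_lt_pow₀ h (by norm_num)
      calc 1 < l ^ 3 * (weight t 0 * weight t 1 * weight t 2) := by rw [h1]; linarith
        _ = _ := by ring)
  exact absurd (hx.2 n hn) (not_le.2 (boxNorm_lt_iff.2 hb))

lemma one_le_abs (hP : P.det = 1) (hx : IsMinimalPoint P t x) {n : Fin 3 → ℤ} (hn : n ≠ 0)
    {c : ℝ} (h : c • embed P x = embed P n) : 1 ≤ |c| := by
  have h1 := hx.2 n hn
  rw [← h, boxNorm_smul] at h1
  exact le_of_mul_le_mul_right (by linarith) (hx.pos hP)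

lemma linearIndependent (hP : P.det = 1) (hx : IsMinimalPoint P t x) {n : Fin 3 → ℤ}
    (hn : n ≠ 0) {i : Fin 3} (h : |embed P n i| < |embed P x i|) :
    LinearIndependent ℝ ![embed P x, embed P n] := by
  rw [LinearIndependent.pair_iff' (embed_ne_zero hP hx.1)]
  intro c hc
  have h1 := hx.one_le_abs hP hn hc
  rw [← hc, Pi.smul_apply, smul_eq_mul, abs_mul] at h
  nlinarith [abs_nonneg (embed P x i)]

/-- The product of the first minimum and the square of the second minimum is at most one. -/
lemma exists_pair_of_one_lt (hP : P.det = 1) (hx : IsMinimalPoint P t x) {l : ℝ} (hl : 0 < l)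
    (h : 1 < boxNorm t (embed P x) * l ^ 2) :
    ∃ y z, LinearIndependent ℝ ![embed P y, embed P z] ∧ boxNorm t (embed P y) ≤ l ∧
      boxNorm t (embed P z) ≤ l := by
  have hμ := hx.pos hP
  have hμ1 := hx.boxNorm_le_one hP
  obtain ⟨i, hi⟩ := exists_abs_eq t (embed P x)
  set μ := boxNorm t (embed P x)
  have hl1 : 1 < l := by
    by_contra! hle
    have : l ^ 2 ≤ 1 := pow_le_one₀ hl.le hle
    nlinarith
  have hw := weight_pos t
  have hprod := weight_prod t
  obtain ⟨n, hn, hb⟩ := exists_embed_lt hP (fun j => (if j = i then μ else l) * weight t j)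
    (fun j => mul_pos (by split_ifs <;> assumption) (hw j)) (by
      have : 1 < (μ * l ^ 2) * (weight t 0 * weight t 1 * weight t 2) := by rw [hprod]; linarith
      refine this.trans_eq ?_
      fin_cases i <;> simp <;> ring)
  refine ⟨x, n, hx.linearIndependent hP hn (i := i) ?_, by linarith, ?_⟩
  · rw [hi]
    simpa using hb i
  · refine boxNorm_le_iff.2 fun j => (hb j).le.trans ?_
    have := hw j
    gcongr
    split_ifs <;> linarith

/-- If the first coordinate dominates in a minimal point, then going back in time one meets a
second, independent minimal point. -/
lemma exists_previous (hP : P.det = 1) (hx : IsMinimalPoint P t x)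
    (hdom : max |embed P x 1| |embed P x 2| * Real.exp t ≤ |embed P x 0| * Real.exp (-2 * t)) :
    ∃ u ≤ t, ∃ y, LinearIndependent ℝ ![embed P x, embed P y] ∧ IsMinimalPoint P u x ∧
      IsMinimalPoint P u y ∧
      boxNorm u (embed P x) = boxNorm t (embed P x) * Real.exp (2 * (t - u)) ∧
      boxNorm u (embed P y) = boxNorm u (embed P x) := by
  have hxt : boxNorm t (embed P x) = |embed P x 0| * Real.exp (-2 * t) := max_eq_left hdom
  have hF : 0 < |embed P x 0| := by
    have := hx.pos hP
    rw [hxt] at this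
    exact pos_of_mul_pos_left this (Real.exp_pos _).le
  set F := |embed P x 0| with hFdef
  let G : (Fin 3 → ℤ) → ℝ := fun n => max |embed P n 1| |embed P n 2|
  obtain ⟨R, hR0, hR⟩ : ∃ R : ℝ, 0 < R ∧ 1 < F * R * R := by
    refine ⟨1 + 1 / F, by positivity, ?_⟩
    have : F * (1 + 1 / F) = F + 1 := by field_simp
    rw [this]
    have : 0 < 1 / F := by positivity
    nlinarith
  obtain ⟨n₀, hn₀, hb₀⟩ := exists_embed_lt hP ![F, R, R]
    (by intro i; fin_cases i <;> simp [hF, hR0]) (by simpa using hR)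
  set S : Set (Fin 3 → ℤ) := {n | n ≠ 0 ∧ |embed P n 0| < F ∧ G n ≤ R} with hS
  have hfin : S.Finite := by
    refine (finite_setOf_embed_le hP (F + R)).subset ?_
    rintro n ⟨-, h0, h1⟩ i
    have h2 := max_le_iff.1 h1
    fin_cases i
    · simp only [Fin.zero_eta]; linarith
    · simp only [Fin.mk_one]; linarith [h2.1]
    · simp only [Fin.reduceFinMk]; linarith [h2.2]
  have hn₀S : n₀ ∈ S := ⟨hn₀, hb₀ 0, max_le (hb₀ 1).le (hb₀ 2).le⟩
  obtain ⟨y, ⟨hy0, hyF, hyR⟩, hymin⟩ := Set.exists_min_image S G hfin ⟨n₀, hn₀S⟩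
  have hmin : ∀ n, n ≠ 0 → |embed P n 0| < F → G y ≤ G n := by
    intro n hn hnF
    by_cases h : G n ≤ R
    · exact hymin n ⟨hn, hnF, h⟩
    · exact hyR.trans (not_le.1 h).le
  have hact : F * Real.exp (-2 * t) ≤ G y * Real.exp t := by
    have h1 := hx.2 y hy0
    rw [hxt, boxNorm] at h1
    rcases le_max_iff.1 h1 with h | h
    · exact absurd (le_of_mul_le_mul_right h (Real.exp_pos _)) (not_le.2 hyF)
    · exact h
  have hδ : 0 < G y := pos_of_mul_pos_left ((mul_pos hF (Real.exp_pos _)).trans_le hact)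
    (Real.exp_pos _).le
  set u := (Real.log F - Real.log (G y)) / 3 with hu
  have hFG : F * Real.exp (-2 * u) = G y * Real.exp u := by
    rw [← Real.exp_log hF, ← Real.exp_log hδ, ← Real.exp_add, ← Real.exp_add]
    congr 1
    rw [hu]
    ring
  have hut : u ≤ t := by
    have h1 := Real.log_le_log (mul_pos hF (Real.exp_pos _)) hact
    rw [Real.log_mul hF.ne' (Real.exp_pos _).ne', Real.log_mul hδ.ne' (Real.exp_pos _).ne',
      Real.log_exp, Real.log_exp] at h1
    rw [hu]
    linarith
  have hGx : G x ≤ G y := by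
    have h1 : G x * Real.exp t ≤ G y * Real.exp t := hdom.trans hact
    exact le_of_mul_le_mul_right h1 (Real.exp_pos _)
  have hxu : boxNorm u (embed P x) = F * Real.exp (-2 * u) := by
    refine max_eq_left ?_
    rw [← hFdef, hFG]
    exact mul_le_mul_of_nonneg_right hGx (Real.exp_pos _).le
  have hyu : boxNorm u (embed P y) = F * Real.exp (-2 * u) := by
    rw [hFG]
    refine max_eq_right ?_
    change _ ≤ G y * Real.exp u
    rw [← hFG]
    exact mul_le_mul_of_nonneg_right hyF.le (Real.exp_pos _).le
  have hlow : ∀ m, m ≠ 0 → F * Real.exp (-2 * u) ≤ boxNorm u (embed P m) := by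
    intro m hm
    by_cases h : F ≤ |embed P m 0|
    · exact le_max_of_le_left (mul_le_mul_of_nonneg_right h (Real.exp_pos _).le)
    · rw [hFG]
      exact le_max_of_le_right
        (mul_le_mul_of_nonneg_right (hmin m hm (not_le.1 h)) (Real.exp_pos _).le)
  refine ⟨u, hut, y, hx.linearIndependent hP hy0 (i := 0) hyF, ⟨hx.1, ?_⟩, ⟨hy0, ?_⟩, ?_, ?_⟩
  · rw [hxu]; exact hlow
  · rw [hyu]; exact hlow
  · rw [hxu, hxt, mul_assoc, ← Real.exp_add]
    ring_nf
  · rw [hxu, hyu]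

/-- If the first coordinate does not dominate in a minimal point, then this point is already
minimal at the earlier time when its trajectory changes direction. -/
lemma exists_corner (hx : IsMinimalPoint P t x) (h0 : 0 < |embed P x 0|)
    (hdom : |embed P x 0| * Real.exp (-2 * t) < max |embed P x 1| |embed P x 2| * Real.exp t) :
    ∃ s ≤ t, IsMinimalPoint P s x ∧
      |embed P x 0| * Real.exp (-2 * s) = max |embed P x 1| |embed P x 2| * Real.exp s ∧
      boxNorm t (embed P x) = boxNorm s (embed P x) * Real.exp (t - s) := by
  have hxt : boxNorm t (embed P x) = max |embed P x 1| |embed P x 2| * Real.exp t :=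
    max_eq_right hdom.le
  set F := |embed P x 0| with hF
  set G := max |embed P x 1| |embed P x 2| with hG
  have hG0 : 0 < G := pos_of_mul_pos_left ((mul_pos h0 (Real.exp_pos _)).trans hdom)
    (Real.exp_pos _).le
  set s := (Real.log F - Real.log G) / 3 with hs
  have hFG : F * Real.exp (-2 * s) = G * Real.exp s := by
    rw [← Real.exp_log h0, ← Real.exp_log hG0, ← Real.exp_add, ← Real.exp_add]
    congr 1
    rw [hs]
    ring
  have hst : s ≤ t := by
    have h1 := Real.log_le_log (mul_pos h0 (Real.exp_pos _)) hdom.le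
    rw [Real.log_mul h0.ne' (Real.exp_pos _).ne', Real.log_mul hG0.ne' (Real.exp_pos _).ne',
      Real.log_exp, Real.log_exp] at h1
    rw [hs]
    linarith
  have hxs : boxNorm s (embed P x) = G * Real.exp s := by
    rw [boxNorm, ← hF, ← hG, hFG, max_self]
  refine ⟨s, hst, ⟨hx.1, fun m hm => ?_⟩, hFG, ?_⟩
  · have h1 := hx.2 m hm
    rw [hxt, boxNorm] at h1
    rw [hxs]
    rcases le_max_iff.1 h1 with h | h
    · have h2 : F ≤ |embed P m 0| :=
        le_of_mul_le_mul_right (hdom.le.trans h) (Real.exp_pos _)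
      rw [← hFG]
      exact le_max_of_le_left (mul_le_mul_of_nonneg_right h2 (Real.exp_pos _).le)
    · have h2 := le_of_mul_le_mul_right h (Real.exp_pos _)
      exact le_max_of_le_right (mul_le_mul_of_nonneg_right h2 (Real.exp_pos _).le)
  · rw [hxt, hxs, mul_assoc, ← Real.exp_add]
    ring_nf

end IsMinimalPoint

end

section

variable {P : Matrix (Fin 3) (Fin 3) ℝ}

/-- `a` and `b` control the decay of the first minimum; the conclusion controls the decay of the
second minimum. -/
theorem exists_pair_boxNorm_le (hP : P.det = 1) {D : Set ℝ} {a b C : ℝ} (ha : -1 ≤ a)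
    (ha2 : a < 2) (hb : -1 ≤ b) (hb2 : b ≤ 2) (hab : 0 < 2 + a - a * b)
    (hD : ∀ t ∈ D, 0 ≤ a * t)
    (hpos : ∀ t ∈ D, ∀ x, IsMinimalPoint P t x → 0 < |embed P x 0|)
    (hcorner : ∀ t ∈ D, ∀ s ≤ t, ∀ x, IsMinimalPoint P t x →
      |embed P x 0| * Real.exp (-2 * s) = max |embed P x 1| |embed P x 2| * Real.exp s → s ∈ D)
    (hup : ∀ t ∈ D, ∀ u ≤ t, ∀ x y, IsMinimalPoint P u x → IsMinimalPoint P u y →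
      LinearIndependent ℝ ![embed P x, embed P y] →
        Real.log (boxNorm u (embed P x)) ≤ -a * u + C)
    (hlow : ∀ t ∈ D, ∀ x, IsMinimalPoint P t x →
      -b * t - C ≤ Real.log (boxNorm t (embed P x))) :
    ∃ C' : ℝ, ∀ t ∈ D, ∃ y z, LinearIndependent ℝ ![embed P y, embed P z] ∧
      boxNorm t (embed P y) ≤ Real.exp ((b - a) / (2 + a - a * b) * t + C') ∧
      boxNorm t (embed P z) ≤ Real.exp ((b - a) / (2 + a - a * b) * t + C') := by
  have h2a : 0 < 2 - a := by linarith
  set T' := (b * (1 + a) - 3 * a) / (2 - a) with hT'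
  set T := (b - a) / (2 + a - a * b) with hT
  set C₁ := (4 + a) * C / (2 - a) with hC₁
  have hT'm : T' * (2 - a) = b * (1 + a) - 3 * a := div_mul_cancel₀ _ h2a.ne'
  have hTm : T * (2 + a - a * b) = b - a := div_mul_cancel₀ _ hab.ne'
  have hC₁m : C₁ * (2 - a) = (4 + a) * C := div_mul_cancel₀ _ h2a.ne'
  have hT'1 : 0 ≤ 1 - T' := by
    have : (1 - T') * (2 - a) = (1 + a) * (2 - b) := by linear_combination -hT'm
    nlinarith [mul_nonneg (by linarith : 0 ≤ 1 + a) (by linarith : 0 ≤ 2 - b)]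
  have hK : 0 < 3 + b - 2 * T' := by
    have : (3 + b - 2 * T') * (2 - a) = 3 * (2 + a - a * b) := by linear_combination -2 * hT'm
    nlinarith
  have hTK : T * (3 + b - 2 * T') = b + T' := by
    have h1 : (3 + b - 2 * T') * (2 - a) = 3 * (2 + a - a * b) := by
      linear_combination -2 * hT'm
    have h2 : (T * (3 + b - 2 * T') - (b + T')) * (2 - a) = 0 := by
      linear_combination T * h1 + 3 * hTm - hT'm
    rcases mul_eq_zero.1 h2 with h | h
    · linarith
    · linarith
  have hTT' : ∀ t ∈ D, T' * t ≤ T * t := by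
    intro t ht
    have h1 : (T - T') * ((2 - a) * (2 + a - a * b)) = a * (1 + a) * (b - 2) ^ 2 := by
      linear_combination (2 - a) * hTm - (2 + a - a * b) * hT'm
    have h2 : 0 ≤ (T - T') * t * ((2 - a) * (2 + a - a * b)) := by
      have : (T - T') * t * ((2 - a) * (2 + a - a * b)) = (a * t) * ((1 + a) * (b - 2) ^ 2) := by
        linear_combination t * h1
      rw [this]
      exact mul_nonneg (hD t ht) (mul_nonneg (by linarith) (sq_nonneg _))
    have := nonneg_of_mul_nonneg_left h2 (mul_pos h2a hab)
    linarith
  have falling : ∀ t ∈ D, ∀ x, IsMinimalPoint P t x →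
      max |embed P x 1| |embed P x 2| * Real.exp t ≤ |embed P x 0| * Real.exp (-2 * t) →
      ∃ y z, LinearIndependent ℝ ![embed P y, embed P z] ∧
        boxNorm t (embed P y) ≤ Real.exp (T' * t + C₁) ∧
        boxNorm t (embed P z) ≤ Real.exp (T' * t + C₁) := by
    intro t ht x hx hdom
    obtain ⟨u, hut, y, hind, hxu, hyu, hx1, hy1⟩ := hx.exists_previous hP hdom
    have hl := hup t ht u hut x y hxu hyu hind
    have hl' := hlow t ht x hx
    have hxp := hx.pos hP
    rw [hx1, Real.log_mul hxp.ne' (Real.exp_pos _).ne', Real.log_exp] at hl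
    set ℓ := Real.log (boxNorm t (embed P x)) with hℓ
    have hxe : boxNorm t (embed P x) = Real.exp ℓ := (Real.exp_log hxp).symm
    have hbound : ℓ + 3 * (t - u) ≤ T' * t + C₁ := by
      have h1 : (ℓ + 3 * (t - u)) * (2 - a) ≤ (T' * t + C₁) * (2 - a) := by
        have h3 : (T' * t + C₁) * (2 - a) = (b * (1 + a) - 3 * a) * t + (4 + a) * C := by
          linear_combination t * hT'm + hC₁m
        rw [h3]
        nlinarith [mul_le_mul_of_nonneg_left hl' (by linarith : 0 ≤ 1 + a)]
      exact le_of_mul_le_mul_right h1 h2a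
    refine ⟨x, y, hind, ?_, ?_⟩
    · rw [hxe]
      exact Real.exp_le_exp.2 (by linarith)
    · calc boxNorm t (embed P y) ≤ boxNorm u (embed P y) * Real.exp (t - u) :=
            boxNorm_le_mul_exp hut _
        _ = Real.exp (ℓ + 3 * (t - u)) := by
            rw [hy1, hx1, hxe, ← Real.exp_add, ← Real.exp_add]
            ring_nf
        _ ≤ _ := Real.exp_le_exp.2 hbound
  set C₂ := ((1 + b) * C₁ + (1 - T') * C) / (3 + b - 2 * T') with hC₂
  have hC₂m : C₂ * (3 + b - 2 * T') = (1 + b) * C₁ + (1 - T') * C := div_mul_cancel₀ _ hK.ne'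
  refine ⟨max C₁ C₂ + 1, fun t ht => ?_⟩
  have hm1 : C₁ ≤ max C₁ C₂ := le_max_left _ _
  have hm2 : C₂ ≤ max C₁ C₂ := le_max_right _ _
  set C' := max C₁ C₂ + 1 with hC'
  obtain ⟨x, hx⟩ := exists_isMinimalPoint hP t
  by_cases hdom : max |embed P x 1| |embed P x 2| * Real.exp t ≤
      |embed P x 0| * Real.exp (-2 * t)
  · obtain ⟨y, z, hyz, hy, hz⟩ := falling t ht x hx hdom
    have h1 := Real.exp_le_exp.2 (by linarith [hTT' t ht] : T' * t + C₁ ≤ T * t + C')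
    exact ⟨y, z, hyz, hy.trans h1, hz.trans h1⟩
  · obtain ⟨s, hst, hxs, hs, hts⟩ := hx.exists_corner (hpos t ht x hx) (not_le.1 hdom)
    have hsD := hcorner t ht s hst x hx hs
    obtain ⟨y, z, hyz, hy, hz⟩ := falling s hsD x hxs hs.ge
    by_contra hno
    have h1 : T * t + C' < T' * s + C₁ + (t - s) := by
      by_contra! hle
      refine hno ⟨y, z, hyz, ?_, ?_⟩
      all_goals
        refine (boxNorm_le_mul_exp hst _).trans (le_trans ?_ (Real.exp_le_exp.2 hle))
        rw [Real.exp_add (T' * s + C₁)]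
        gcongr
    have h2 : Real.log (boxNorm t (embed P x)) + 2 * (T * t + C') ≤ 0 := by
      by_contra! hlt
      refine hno (hx.exists_pair_of_one_lt hP (Real.exp_pos _) ?_)
      rw [← Real.exp_log (hx.pos hP), ← Real.exp_nat_mul, ← Real.exp_add, Real.one_lt_exp_iff]
      simpa using hlt
    have h3 := hlow s hsD x hxs
    rw [hts, Real.log_mul (hxs.pos hP).ne' (Real.exp_pos _).ne', Real.log_exp] at h2
    have h4 : (1 + b) * (T * t + C') ≤ (1 + b) * (T' * s + C₁ + (t - s)) :=
      mul_le_mul_of_nonneg_left h1.le (by linarith)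
    have h5 : (1 - T') * (2 * (T * t + C')) ≤ (1 - T') * (b * s + C - (t - s)) :=
      mul_le_mul_of_nonneg_left (by linarith) hT'1
    have h6 : (T * t + C') * (3 + b - 2 * T') ≤ (T * t + C₂) * (3 + b - 2 * T') := by
      have : (T * t + C₂) * (3 + b - 2 * T') =
          (b + T') * t + ((1 + b) * C₁ + (1 - T') * C) := by
        linear_combination t * hTK + hC₂m
      rw [this]
      linarith
    have := le_of_mul_le_mul_right h6 hK
    linarith

end

section

/-- Generators of `LatticeSet ξ₁ ξ₂`. -/
def latticeMatrix (ξ₁ ξ₂ : ℝ) : Matrix (Fin 3) (Fin 3) ℝ :=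
  !![1, 0, 0; ξ₁, -1, 0; ξ₂, 0, -1]

/-- Generators of the dual lattice of `LatticeSet ξ₁ ξ₂`. -/
def dualMatrix (ξ₁ ξ₂ : ℝ) : Matrix (Fin 3) (Fin 3) ℝ :=
  !![1, ξ₁, ξ₂; 0, -1, 0; 0, 0, -1]

variable {ξ₁ ξ₂ : ℝ}

lemma det_latticeMatrix : (latticeMatrix ξ₁ ξ₂).det = 1 := by
  simp [latticeMatrix, Matrix.det_fin_three]

lemma det_dualMatrix : (dualMatrix ξ₁ ξ₂).det = 1 := by
  simp [dualMatrix, Matrix.det_fin_three]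

lemma embed_latticeMatrix (n : Fin 3 → ℤ) :
    embed (latticeMatrix ξ₁ ξ₂) n = ![(n 0 : ℝ), ξ₁ * n 0 - n 1, ξ₂ * n 0 - n 2] := by
  ext i
  fin_cases i <;> simp [embed, latticeMatrix, Matrix.mulVec, dotProduct, Fin.sum_univ_three] <;>
    ring

lemma embed_dualMatrix (n : Fin 3 → ℤ) :
    embed (dualMatrix ξ₁ ξ₂) n = ![n 0 + n 1 * ξ₁ + n 2 * ξ₂, -(n 1 : ℝ), -(n 2 : ℝ)] := by
  ext i
  fin_cases i <;> simp [embed, dualMatrix, Matrix.mulVec, dotProduct, Fin.sum_univ_three]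
  ring

lemma embed_dotProduct_embed (n m : Fin 3 → ℤ) :
    embed (latticeMatrix ξ₁ ξ₂) n ⬝ᵥ embed (dualMatrix ξ₁ ξ₂) m = ((n ⬝ᵥ m : ℤ) : ℝ) := by
  rw [embed_latticeMatrix, embed_dualMatrix]
  simp [dotProduct, Fin.sum_univ_three]
  ring

lemma embed_latticeMatrix_cross (n m : Fin 3 → ℤ) :
    embed (latticeMatrix ξ₁ ξ₂) (n ⨯₃ m) =
      embed (dualMatrix ξ₁ ξ₂) n ⨯₃ embed (dualMatrix ξ₁ ξ₂) m := by
  rw [embed_latticeMatrix, embed_dualMatrix, embed_dualMatrix, cross_apply, cross_apply]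
  ext i
  fin_cases i <;> simp <;> ring

lemma embed_dualMatrix_cross (n m : Fin 3 → ℤ) :
    embed (dualMatrix ξ₁ ξ₂) (n ⨯₃ m) =
      embed (latticeMatrix ξ₁ ξ₂) n ⨯₃ embed (latticeMatrix ξ₁ ξ₂) m := by
  rw [embed_dualMatrix, embed_latticeMatrix, embed_latticeMatrix, cross_apply, cross_apply]
  ext i
  fin_cases i <;> simp <;> ring

lemma weight_mul_weight_neg (t : ℝ) (i : Fin 3) : weight t i * weight (-t) i = 1 := by
  fin_cases i <;> simp [weight, ← Real.exp_add]

lemma abs_dotProduct_le (t : ℝ) (v w : Fin 3 → ℝ) :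
    |v ⬝ᵥ w| ≤ 3 * (boxNorm t v * boxNorm (-t) w) := by
  have h : ∀ i, |v i * w i| ≤ boxNorm t v * boxNorm (-t) w := by
    intro i
    rw [abs_mul]
    calc |v i| * |w i| ≤ (boxNorm t v * weight t i) * (boxNorm (-t) w * weight (-t) i) :=
          mul_le_mul (abs_apply_le _ _ _) (abs_apply_le _ _ _) (abs_nonneg _)
            (mul_nonneg (boxNorm_nonneg _ _) (weight_pos _ _).le)
      _ = boxNorm t v * boxNorm (-t) w * (weight t i * weight (-t) i) := by ring
      _ = _ := by rw [weight_mul_weight_neg, mul_one]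
  calc |v ⬝ᵥ w| ≤ ∑ i, |v i * w i| := Finset.abs_sum_le_sum_abs _ _
    _ ≤ ∑ _i : Fin 3, boxNorm t v * boxNorm (-t) w := Finset.sum_le_sum fun i _ => h i
    _ = _ := by simp

lemma one_le_of_dotProduct_ne_zero (t : ℝ) {n m : Fin 3 → ℤ}
    (h : embed (latticeMatrix ξ₁ ξ₂) n ⬝ᵥ embed (dualMatrix ξ₁ ξ₂) m ≠ 0) :
    1 ≤ 3 * (boxNorm t (embed (latticeMatrix ξ₁ ξ₂) n) *
      boxNorm (-t) (embed (dualMatrix ξ₁ ξ₂) m)) := by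
  refine le_trans ?_ (abs_dotProduct_le t _ _)
  rw [embed_dotProduct_embed] at h ⊢
  exact_mod_cast Int.one_le_abs (by exact_mod_cast h)

lemma boxNorm_cross_le (t : ℝ) (v w : Fin 3 → ℝ) :
    boxNorm (-t) (v ⨯₃ w) ≤ 2 * (boxNorm t v * boxNorm t w) := by
  have key : ∀ i j k : Fin 3, weight t i * weight t j = weight (-t) k →
      |v i * w j - v j * w i| ≤ 2 * (boxNorm t v * boxNorm t w) * weight (-t) k := by
    intro i j k h
    have hb : ∀ i j : Fin 3, |v i * w j| ≤
        (boxNorm t v * weight t i) * (boxNorm t w * weight t j) := by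
      intro i j
      rw [abs_mul]
      exact mul_le_mul (abs_apply_le _ _ _) (abs_apply_le _ _ _) (abs_nonneg _)
        (mul_nonneg (boxNorm_nonneg _ _) (weight_pos _ _).le)
    rw [← h]
    linarith [abs_sub (v i * w j) (v j * w i), hb i j, hb j i]
  rw [boxNorm_le_iff, cross_apply]
  intro i
  fin_cases i
  · exact key 1 2 0 (by simp [weight, ← Real.exp_add]; ring)
  · exact key 2 0 1 (by simp [weight, ← Real.exp_add]; ring)
  · exact key 0 1 2 (by simp [weight, ← Real.exp_add]; ring)

lemma linearIndependent_iff_det_ne_zero {v : Fin 3 → Fin 3 → ℝ} :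
    LinearIndependent ℝ v ↔ (Matrix.of v).det ≠ 0 := by
  rw [← isUnit_iff_ne_zero, ← Matrix.isUnit_iff_isUnit_det,
    ← Matrix.linearIndependent_rows_iff_isUnit]
  rfl

lemma linearIndependent_cross {u v w : Fin 3 → ℝ} (h : LinearIndependent ℝ ![u, v, w]) :
    LinearIndependent ℝ ![u ⨯₃ v, u ⨯₃ w, v ⨯₃ w] := by
  rw [linearIndependent_iff_det_ne_zero] at h ⊢
  have : (Matrix.of ![u ⨯₃ v, u ⨯₃ w, v ⨯₃ w]).det = (Matrix.of ![u, v, w]).det ^ 2 := by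
    simp [Matrix.det_fin_three, cross_apply]
    ring
  rw [this]
  exact pow_ne_zero 2 h

lemma exists_dotProduct_ne_zero {v : Fin 3 → Fin 3 → ℝ} (hv : LinearIndependent ℝ v)
    {w : Fin 3 → ℝ} (hw : w ≠ 0) : ∃ i, v i ⬝ᵥ w ≠ 0 := by
  by_contra! h
  exact hw (Matrix.eq_zero_of_mulVec_eq_zero (linearIndependent_iff_det_ne_zero.1 hv)
    (funext fun i => h i))

lemma exists_dotProduct_ne_zero_of_pair {v₁ v₂ w₁ w₂ : Fin 3 → ℝ}
    (hv : LinearIndependent ℝ ![v₁, v₂]) (hw : LinearIndependent ℝ ![w₁, w₂]) :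
    v₁ ⬝ᵥ w₁ ≠ 0 ∨ v₁ ⬝ᵥ w₂ ≠ 0 ∨ v₂ ⬝ᵥ w₁ ≠ 0 ∨ v₂ ⬝ᵥ w₂ ≠ 0 := by
  by_contra! h
  obtain ⟨h11, h12, h21, h22⟩ := h
  have hn : v₁ ⨯₃ v₂ ≠ 0 := crossProduct_ne_zero_iff_linearIndependent.2 hv
  have hpar : ∀ w : Fin 3 → ℝ, v₁ ⬝ᵥ w = 0 → v₂ ⬝ᵥ w = 0 → ∃ c : ℝ, c • (v₁ ⨯₃ v₂) = w := by
    intro w h1 h2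
    by_contra! hc
    have := crossProduct_ne_zero_iff_linearIndependent.2 ((LinearIndependent.pair_iff' hn).2 hc)
    refine this ?_
    rw [cross_cross_eq_smul_sub_smul, h1, h2]
    simp
  obtain ⟨c₁, hc₁⟩ := hpar w₁ h11 h21
  obtain ⟨c₂, hc₂⟩ := hpar w₂ h12 h22
  refine crossProduct_ne_zero_iff_linearIndependent.2 hw ?_
  rw [← hc₁, ← hc₂]
  simp

lemma one_le_of_pairs (t : ℝ) {l k : ℝ} {n₁ n₂ m₁ m₂ : Fin 3 → ℤ}
    (hn : LinearIndependent ℝ ![embed (latticeMatrix ξ₁ ξ₂) n₁, embed (latticeMatrix ξ₁ ξ₂) n₂])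
    (hm : LinearIndependent ℝ ![embed (dualMatrix ξ₁ ξ₂) m₁, embed (dualMatrix ξ₁ ξ₂) m₂])
    (hn₁ : boxNorm t (embed (latticeMatrix ξ₁ ξ₂) n₁) ≤ l)
    (hn₂ : boxNorm t (embed (latticeMatrix ξ₁ ξ₂) n₂) ≤ l)
    (hm₁ : boxNorm (-t) (embed (dualMatrix ξ₁ ξ₂) m₁) ≤ k)
    (hm₂ : boxNorm (-t) (embed (dualMatrix ξ₁ ξ₂) m₂) ≤ k) : 1 ≤ 3 * (l * k) := by
  have hl := (boxNorm_nonneg _ _).trans hn₁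
  rcases exists_dotProduct_ne_zero_of_pair hn hm with h | h | h | h
  all_goals
    refine (one_le_of_dotProduct_ne_zero t h).trans ?_
    have hk := boxNorm_nonneg (-t) (embed (dualMatrix ξ₁ ξ₂) m₁)
    have hk' := boxNorm_nonneg (-t) (embed (dualMatrix ξ₁ ξ₂) m₂)
    gcongr

lemma one_le_of_triple (t : ℝ) {l : ℝ} {n : Fin 3 → Fin 3 → ℤ}
    (hn : LinearIndependent ℝ fun i => embed (latticeMatrix ξ₁ ξ₂) (n i))
    (hl : ∀ i, boxNorm t (embed (latticeMatrix ξ₁ ξ₂) (n i)) ≤ l) {m : Fin 3 → ℤ} (hm : m ≠ 0) :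
    1 ≤ 3 * (l * boxNorm (-t) (embed (dualMatrix ξ₁ ξ₂) m)) := by
  obtain ⟨i, hi⟩ := exists_dotProduct_ne_zero hn (embed_ne_zero det_dualMatrix hm)
  refine (one_le_of_dotProduct_ne_zero t hi).trans ?_
  have := boxNorm_nonneg (-t) (embed (dualMatrix ξ₁ ξ₂) m)
  gcongr
  exact hl i

lemma one_le_of_triple_of_ne_zero (t : ℝ) {l : ℝ} {n : Fin 3 → Fin 3 → ℤ}
    (hn : LinearIndependent ℝ fun i => embed (latticeMatrix ξ₁ ξ₂) (n i))
    (hl : ∀ i, boxNorm t (embed (latticeMatrix ξ₁ ξ₂) (n i)) ≤ l) {m : Fin 3 → ℤ} (hm : m ≠ 0) :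
    1 ≤ 6 * (boxNorm t (embed (latticeMatrix ξ₁ ξ₂) m) * l ^ 2) := by
  have hn' : LinearIndependent ℝ ![embed (latticeMatrix ξ₁ ξ₂) (n 0),
      embed (latticeMatrix ξ₁ ξ₂) (n 1), embed (latticeMatrix ξ₁ ξ₂) (n 2)] := by
    convert hn using 1
    ext i
    fin_cases i <;> rfl
  have hl0 := (boxNorm_nonneg _ _).trans (hl 0)
  have key : ∀ i j, (embed (latticeMatrix ξ₁ ξ₂) (n i) ⨯₃ embed (latticeMatrix ξ₁ ξ₂) (n j)) ⬝ᵥ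
      embed (latticeMatrix ξ₁ ξ₂) m ≠ 0 →
      1 ≤ 6 * (boxNorm t (embed (latticeMatrix ξ₁ ξ₂) m) * l ^ 2) := by
    intro i j h
    rw [← embed_dualMatrix_cross, dotProduct_comm] at h
    refine (one_le_of_dotProduct_ne_zero t h).trans ?_
    have h1 : boxNorm (-t) (embed (dualMatrix ξ₁ ξ₂) (n i ⨯₃ n j)) ≤ 2 * (l * l) := by
      rw [embed_dualMatrix_cross]
      refine (boxNorm_cross_le t _ _).trans ?_
      have := boxNorm_nonneg t (embed (latticeMatrix ξ₁ ξ₂) (n j))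
      gcongr
      exacts [hl i, hl j]
    have := mul_le_mul_of_nonneg_left h1 (boxNorm_nonneg t (embed (latticeMatrix ξ₁ ξ₂) m))
    nlinarith
  obtain ⟨i, hi⟩ := exists_dotProduct_ne_zero (linearIndependent_cross hn')
    (embed_ne_zero det_latticeMatrix hm)
  fin_cases i
  exacts [key 0 1 hi, key 0 2 hi, key 1 2 hi]

lemma IsMinimalPoint.exists_third {P : Matrix (Fin 3) (Fin 3) ℝ} (hP : P.det = 1) {t : ℝ}
    {w v : Fin 3 → ℤ} (hw : IsMinimalPoint P t w)
    (hwv : LinearIndependent ℝ ![embed P w, embed P v]) :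
    ∃ r, LinearIndependent ℝ ![embed P w, embed P v, embed P r] ∧
      boxNorm t (embed P r) ≤ 18 / boxNorm t (embed P w) ^ 2 := by
  have hμ := hw.pos hP
  have hμ1 := hw.boxNorm_le_one hP
  have hmin := hw.2
  set μ := boxNorm t (embed P w)
  have hwt := weight_pos t
  have hprod := weight_prod t
  set c := embed P w ⨯₃ embed P v with hc
  have hc0 : c ≠ 0 := crossProduct_ne_zero_iff_linearIndependent.2 hwv
  obtain ⟨k, hk⟩ := Finite.exists_max fun i => |c i| * weight t i
  have hck : 0 < |c k| * weight t k := by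
    by_contra! h
    refine hc0 (funext fun i => abs_nonpos_iff.1 ?_)
    exact nonpos_of_mul_nonpos_left ((hk i).trans h) (hwt i)
  have hle : μ / 3 ≤ 18 / μ ^ 2 := by
    rw [div_le_div_iff₀ three_pos (by positivity)]
    have : μ * μ ^ 2 ≤ 1 := by
      rw [← pow_succ']
      exact pow_le_one₀ hμ.le hμ1
    linarith
  obtain ⟨r, hr, hb⟩ := exists_embed_lt hP
    (fun j => (if j = k then 18 / μ ^ 2 else μ / 3) * weight t j)
    (fun j => mul_pos (by split_ifs <;> positivity) (hwt j)) (by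
      have h2 : μ / 3 * (μ / 3) * (18 / μ ^ 2) = 2 := by
        field_simp
        norm_num
      have : (1 : ℝ) < μ / 3 * (μ / 3) * (18 / μ ^ 2) *
          (weight t 0 * weight t 1 * weight t 2) := by
        rw [hprod, h2]
        norm_num
      refine this.trans_eq ?_
      fin_cases k <;> simp <;> ring)
  refine ⟨r, ?_, ?_⟩
  · have hdet : (Matrix.of ![embed P w, embed P v, embed P r]).det = c ⬝ᵥ embed P r := by
      simp [hc, Matrix.det_fin_three, cross_apply, dotProduct, Fin.sum_univ_three]
      ring
    rw [linearIndependent_iff_det_ne_zero, hdet]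
    intro h0
    refine absurd (hmin r hr) (not_le.2 (boxNorm_lt_iff.2 ?_))
    have hother : ∀ i ≠ k, |c i * embed P r i| ≤ |c k| * weight t k * (μ / 3) := by
      intro i hi
      have h1 := (hb i).le
      simp only [if_neg hi] at h1
      rw [abs_mul]
      calc |c i| * |embed P r i| ≤ |c i| * (μ / 3 * weight t i) :=
            mul_le_mul_of_nonneg_left h1 (abs_nonneg _)
        _ = |c i| * weight t i * (μ / 3) := by ring
        _ ≤ _ := mul_le_mul_of_nonneg_right (hk i) (by positivity)
    have hkk : |c k| * |embed P r k| < |c k| * (μ * weight t k) := by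
      rw [← abs_mul]
      rw [dotProduct, Fin.sum_univ_three] at h0
      have hsum : |c k * embed P r k| ≤ 2 * (|c k| * weight t k * (μ / 3)) := by
        fin_cases k
        · have h1 := hother 1 (by simp)
          have h2 := hother 2 (by simp)
          simp only [abs_le, Fin.zero_eta] at h1 h2 ⊢
          constructor <;> linarith
        · have h1 := hother 0 (by simp)
          have h2 := hother 2 (by simp)
          simp only [abs_le, Fin.mk_one] at h1 h2 ⊢
          constructor <;> linarith
        · have h1 := hother 0 (by simp)
          have h2 := hother 1 (by simp)
          simp only [abs_le, Fin.reduceFinMk] at h1 h2 ⊢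
          constructor <;> linarith
      nlinarith [mul_pos hck hμ]
    intro i
    by_cases hi : i = k
    · subst hi
      exact lt_of_mul_lt_mul_left hkk (abs_nonneg _)
    · have h1 := hb i
      simp only [if_neg hi] at h1
      have := hwt i
      nlinarith
  · refine boxNorm_le_iff.2 fun j => (hb j).le.trans ?_
    have := hwt j
    gcongr
    split_ifs
    exacts [le_rfl, hle]

end

section

variable {ξ₁ ξ₂ : ℝ} {j : ℕ} {q : ℝ}

lemma linearIndependent_three {v : Fin 3 → Fin 3 → ℝ} (h : LinearIndependent ℝ ![v 0, v 1, v 2]) :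
    LinearIndependent ℝ v := by
  convert h using 1
  ext i
  fin_cases i <;> rfl

lemma exists_triple_of_minimal_pair {t : ℝ} {w v : Fin 3 → ℤ}
    (hw : IsMinimalPoint (dualMatrix ξ₁ ξ₂) t w) (hv : IsMinimalPoint (dualMatrix ξ₁ ξ₂) t v)
    (hwv : LinearIndependent ℝ ![embed (dualMatrix ξ₁ ξ₂) w, embed (dualMatrix ξ₁ ξ₂) v]) :
    ∃ n : Fin 3 → Fin 3 → ℤ, (LinearIndependent ℝ fun i => embed (latticeMatrix ξ₁ ξ₂) (n i)) ∧
      ∀ i, boxNorm (-t) (embed (latticeMatrix ξ₁ ξ₂) (n i)) ≤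
        36 / boxNorm t (embed (dualMatrix ξ₁ ξ₂) w) := by
  obtain ⟨r, hr, hrb⟩ := hw.exists_third det_dualMatrix hwv
  have hμ := hw.pos det_dualMatrix
  have hμ1 := hw.boxNorm_le_one det_dualMatrix
  have hvw : boxNorm t (embed (dualMatrix ξ₁ ξ₂) v) ≤ boxNorm t (embed (dualMatrix ξ₁ ξ₂) w) :=
    hv.2 w hw.1
  set μ := boxNorm t (embed (dualMatrix ξ₁ ξ₂) w)
  have hμr : μ * boxNorm t (embed (dualMatrix ξ₁ ξ₂) r) ≤ 18 / μ := by
    calc μ * boxNorm t (embed (dualMatrix ξ₁ ξ₂) r) ≤ μ * (18 / μ ^ 2) := by gcongr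
      _ = 18 / μ := by field_simp
  have hr0 := boxNorm_nonneg t (embed (dualMatrix ξ₁ ξ₂) r)
  refine ⟨![w ⨯₃ v, w ⨯₃ r, v ⨯₃ r], linearIndependent_three ?_, ?_⟩
  · simpa only [cons_val, embed_latticeMatrix_cross] using linearIndependent_cross hr
  · have h36 : 36 / μ = 2 * (18 / μ) := by ring
    intro i
    rw [h36]
    fin_cases i
    · simp only [Fin.zero_eta, cons_val, embed_latticeMatrix_cross]
      refine (boxNorm_cross_le t _ _).trans ?_
      have : μ * boxNorm t (embed (dualMatrix ξ₁ ξ₂) v) ≤ 1 := mul_le_one₀ hμ1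
        (boxNorm_nonneg _ _) (hvw.trans hμ1)
      have : 18 ≤ 18 / μ := le_div_self (by norm_num) hμ hμ1
      linarith
    · simp only [Fin.mk_one, cons_val, embed_latticeMatrix_cross]
      refine (boxNorm_cross_le t _ _).trans ?_
      linarith
    · simp only [Fin.reduceFinMk, cons_val, embed_latticeMatrix_cross]
      refine (boxNorm_cross_le t _ _).trans ?_
      have := mul_le_mul_of_nonneg_right hvw hr0
      linarith

lemma mem_smul_Box_iff {l : ℝ} (hl : 0 < l) {v : Fin 3 → ℝ} :
    v ∈ l • Box q ↔ boxNorm q v ≤ l := by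
  rw [Set.mem_smul_set_iff_inv_smul_mem₀ hl.ne', boxNorm_le_iff]
  simp [Box, weight, Fin.forall_fin_succ, abs_mul, abs_of_pos hl, inv_mul_le_iff₀ hl]

lemma mem_LatticeSet_iff {v : Fin 3 → ℝ} :
    v ∈ LatticeSet ξ₁ ξ₂ ↔ ∃ n, embed (latticeMatrix ξ₁ ξ₂) n = v := by
  simp only [embed_latticeMatrix]
  constructor
  · rintro ⟨x, y₁, y₂, h0, h1, h2⟩
    refine ⟨![x, y₁, y₂], ?_⟩
    ext i
    fin_cases i <;> simp [h0, h1, h2]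
  · rintro ⟨n, rfl⟩
    exact ⟨n 0, n 1, n 2, by simp⟩

lemma lambdaMin_le {l : ℝ} (hl : 0 < l) {n : Fin j → Fin 3 → ℤ}
    (hn : LinearIndependent ℝ fun i => embed (latticeMatrix ξ₁ ξ₂) (n i))
    (hb : ∀ i, boxNorm q (embed (latticeMatrix ξ₁ ξ₂) (n i)) ≤ l) :
    lambdaMin ξ₁ ξ₂ j q ≤ l :=
  csInf_le ⟨0, fun _ h => h.1.le⟩ ⟨hl, _, hn, fun i =>
    ⟨mem_LatticeSet_iff.2 ⟨n i, rfl⟩, (mem_smul_Box_iff hl).2 (hb i)⟩⟩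

lemma exists_triple_boxNorm_le (ξ₁ ξ₂ : ℝ) (hq : 0 ≤ q) : ∃ n : Fin 3 → Fin 3 → ℤ,
    (LinearIndependent ℝ fun i => embed (latticeMatrix ξ₁ ξ₂) (n i)) ∧
      ∀ i, boxNorm q (embed (latticeMatrix ξ₁ ξ₂) (n i)) ≤ Real.exp q := by
  refine ⟨![![1, ⌊ξ₁⌋, ⌊ξ₂⌋], ![0, 1, 0], ![0, 0, 1]], ?_, ?_⟩
  · rw [linearIndependent_iff_det_ne_zero]
    simp [Matrix.det_fin_three, embed_latticeMatrix]
  · have h1 : Real.exp (-2 * q) ≤ Real.exp q := Real.exp_le_exp.2 (by linarith)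
    have hfract : ∀ ξ : ℝ, |Int.fract ξ| ≤ 1 := fun ξ => by
      rw [Int.abs_fract]
      exact (Int.fract_lt_one ξ).le
    intro i
    have hexp := Real.exp_pos q
    fin_cases i
    · refine max_le ?_ (mul_le_of_le_one_left hexp.le (max_le ?_ ?_)) <;>
        simp [embed_latticeMatrix, hfract]
      linarith
    · refine max_le ?_ (mul_le_of_le_one_left hexp.le (max_le ?_ ?_)) <;>
        simp [embed_latticeMatrix, hexp.le]
    · refine max_le ?_ (mul_le_of_le_one_left hexp.le (max_le ?_ ?_)) <;>
        simp [embed_latticeMatrix, hexp.le]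

lemma le_lambdaMin {c : ℝ} (hj : j ≤ 3) (hq : 0 ≤ q)
    (h : ∀ l, 0 < l → ∀ n : Fin j → Fin 3 → ℤ,
      (LinearIndependent ℝ fun i => embed (latticeMatrix ξ₁ ξ₂) (n i)) →
        (∀ i, boxNorm q (embed (latticeMatrix ξ₁ ξ₂) (n i)) ≤ l) → c ≤ l) :
    c ≤ lambdaMin ξ₁ ξ₂ j q := by
  refine le_csInf ?_ ?_
  · obtain ⟨n, hn, hb⟩ := exists_triple_boxNorm_le ξ₁ ξ₂ hq
    refine ⟨Real.exp q, Real.exp_pos _, fun i => embed (latticeMatrix ξ₁ ξ₂) (n (Fin.castLE hj i)),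
      hn.comp _ (Fin.castLE_injective hj), fun i => ⟨mem_LatticeSet_iff.2 ⟨_, rfl⟩,
        (mem_smul_Box_iff (Real.exp_pos _)).2 (hb _)⟩⟩
  · rintro l ⟨hl, v, hv, hm⟩
    choose n hn using fun i => mem_LatticeSet_iff.1 (hm i).1
    obtain rfl : (fun i => embed (latticeMatrix ξ₁ ξ₂) (n i)) = v := funext hn
    exact h l hl n hv fun i => (mem_smul_Box_iff hl).1 (hm i).2

lemma exp_le_boxNorm (hq : 0 ≤ q) {n : Fin 3 → ℤ} (hn : n ≠ 0) :
    Real.exp (-2 * q) ≤ boxNorm q (embed (latticeMatrix ξ₁ ξ₂) n) := by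
  have hone : ∀ k : ℤ, k ≠ 0 → (1 : ℝ) ≤ |(k : ℝ)| := fun k hk => by
    exact_mod_cast Int.one_le_abs hk
  have h1 : Real.exp (-2 * q) ≤ Real.exp q := Real.exp_le_exp.2 (by linarith)
  simp only [boxNorm, embed_latticeMatrix, cons_val]
  by_cases h0 : n 0 = 0
  · refine le_max_of_le_right (h1.trans (le_mul_of_one_le_left (Real.exp_pos _).le ?_))
    by_cases h1 : n 1 = 0
    · have h2 : n 2 ≠ 0 := fun h2 => hn (funext fun i => by fin_cases i <;> simp [*])
      exact le_max_of_le_right (by simpa [h0] using hone _ h2)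
    · exact le_max_of_le_left (by simpa [h0] using hone _ h1)
  · exact le_max_of_le_left (le_mul_of_one_le_left (Real.exp_pos _).le (hone _ h0))

lemma ne_zero_of_linearIndependent {n : Fin j → Fin 3 → ℤ} {P : Matrix (Fin 3) (Fin 3) ℝ}
    (hn : LinearIndependent ℝ fun i => embed P (n i)) (i : Fin j) : n i ≠ 0 := by
  intro h
  refine hn.ne_zero i ?_
  simp only [h]
  exact Matrix.mulVec_zero P ▸ by simp [embed, Pi.zero_def]

lemma exp_le_lambdaMin (hj1 : 1 ≤ j) (hj : j ≤ 3) (hq : 0 ≤ q) :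
    Real.exp (-2 * q) ≤ lambdaMin ξ₁ ξ₂ j q :=
  le_lambdaMin hj hq fun _ _ _ hn hb =>
    (exp_le_boxNorm hq (ne_zero_of_linearIndependent hn ⟨0, hj1⟩)).trans (hb _)

lemma Lmin_le {c : ℝ} (hj1 : 1 ≤ j) (hj : j ≤ 3) (hq : 0 ≤ q) {n : Fin j → Fin 3 → ℤ}
    (hn : LinearIndependent ℝ fun i => embed (latticeMatrix ξ₁ ξ₂) (n i))
    (hb : ∀ i, boxNorm q (embed (latticeMatrix ξ₁ ξ₂) (n i)) ≤ Real.exp c) :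
    Lmin ξ₁ ξ₂ j q ≤ c := by
  rw [Lmin, Real.log_le_iff_le_exp ((Real.exp_pos _).trans_le (exp_le_lambdaMin hj1 hj hq))]
  exact lambdaMin_le (Real.exp_pos _) hn hb

lemma le_Lmin {c : ℝ} (hj : j ≤ 3) (hq : 0 ≤ q)
    (h : ∀ l, 0 < l → ∀ n : Fin j → Fin 3 → ℤ,
      (LinearIndependent ℝ fun i => embed (latticeMatrix ξ₁ ξ₂) (n i)) →
        (∀ i, boxNorm q (embed (latticeMatrix ξ₁ ξ₂) (n i)) ≤ l) → c ≤ Real.log l) :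
    c ≤ Lmin ξ₁ ξ₂ j q := by
  have h' : Real.exp c ≤ lambdaMin ξ₁ ξ₂ j q := le_lambdaMin hj hq fun l hl n hn hb =>
    (Real.le_log_iff_exp_le hl).1 (h l hl n hn hb)
  exact (Real.le_log_iff_exp_le ((Real.exp_pos _).trans_le h')).2 h'

lemma neg_two_mul_le_Lmin (hj1 : 1 ≤ j) (hj : j ≤ 3) (hq : 0 ≤ q) :
    -2 * q ≤ Lmin ξ₁ ξ₂ j q :=
  (Real.le_log_iff_exp_le ((Real.exp_pos _).trans_le (exp_le_lambdaMin hj1 hj hq))).2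
    (exp_le_lambdaMin hj1 hj hq)

lemma Lmin_le_self (hj1 : 1 ≤ j) (hj : j ≤ 3) (hq : 0 ≤ q) : Lmin ξ₁ ξ₂ j q ≤ q := by
  obtain ⟨n, hn, hb⟩ := exists_triple_boxNorm_le ξ₁ ξ₂ hq
  exact Lmin_le hj1 hj hq (n := fun i => n (Fin.castLE hj i))
    (hn.comp _ (Fin.castLE_injective hj)) fun i => hb _

lemma Lmin_one_eq (hq : 0 ≤ q) {x : Fin 3 → ℤ}
    (hx : IsMinimalPoint (latticeMatrix ξ₁ ξ₂) q x) :
    Lmin ξ₁ ξ₂ 1 q = Real.log (boxNorm q (embed (latticeMatrix ξ₁ ξ₂) x)) := by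
  have hpos := hx.pos det_latticeMatrix
  refine le_antisymm ?_ ?_
  · refine Lmin_le le_rfl (by norm_num) hq (n := fun _ => x) ?_ fun _ => (Real.exp_log hpos).ge
    exact LinearIndependent.of_subsingleton 0 (embed_ne_zero det_latticeMatrix hx.1)
  · refine le_Lmin (by norm_num) hq fun l _ n hn hb => Real.log_le_log hpos ?_
    exact (hx.2 _ (ne_zero_of_linearIndependent hn 0)).trans (hb 0)

lemma Lmin_one_nonpos (hq : 0 ≤ q) : Lmin ξ₁ ξ₂ 1 q ≤ 0 := by
  obtain ⟨x, hx⟩ := exists_isMinimalPoint (det_latticeMatrix (ξ₁ := ξ₁) (ξ₂ := ξ₂)) q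
  rw [Lmin_one_eq hq hx]
  exact Real.log_nonpos (boxNorm_nonneg _ _) (hx.boxNorm_le_one det_latticeMatrix)

lemma neg_log_le_Lmin_one_add (hq : 0 ≤ q) :
    -Real.log 6 ≤ Lmin ξ₁ ξ₂ 1 q + 2 * Lmin ξ₁ ξ₂ 3 q := by
  obtain ⟨x, hx⟩ := exists_isMinimalPoint (det_latticeMatrix (ξ₁ := ξ₁) (ξ₂ := ξ₂)) q
  have hpos := hx.pos det_latticeMatrix
  have : (-Real.log 6 - Lmin ξ₁ ξ₂ 1 q) / 2 ≤ Lmin ξ₁ ξ₂ 3 q := by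
    refine le_Lmin le_rfl hq fun l hl n hn hb => ?_
    have h := Real.log_nonneg (one_le_of_triple_of_ne_zero q hn hb hx.1)
    rw [Real.log_mul (by norm_num) (by positivity), Real.log_mul hpos.ne' (by positivity),
      Real.log_pow, ← Lmin_one_eq hq hx] at h
    push_cast at h
    linarith
  linarith

end

section

variable {ξ₁ ξ₂ : ℝ} {j : ℕ} {a b c C : ℝ}

lemma neg_two_le_Lmin_div (hj1 : 1 ≤ j) (hj : j ≤ 3) :
    ∀ᶠ q : ℝ in atTop, -2 ≤ Lmin ξ₁ ξ₂ j q / q := by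
  filter_upwards [eventually_gt_atTop 0] with q hq
  rw [le_div_iff₀ hq]
  exact neg_two_mul_le_Lmin hj1 hj hq.le

lemma Lmin_div_le_one (hj1 : 1 ≤ j) (hj : j ≤ 3) :
    ∀ᶠ q : ℝ in atTop, Lmin ξ₁ ξ₂ j q / q ≤ 1 := by
  filter_upwards [eventually_gt_atTop 0] with q hq
  rw [div_le_one hq]
  exact Lmin_le_self hj1 hj hq.le

lemma isBoundedUnder_le_Lmin_div (hj1 : 1 ≤ j) (hj : j ≤ 3) :
    IsBoundedUnder (· ≤ ·) atTop fun q : ℝ => Lmin ξ₁ ξ₂ j q / q :=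
  ⟨1, Lmin_div_le_one hj1 hj⟩

lemma isBoundedUnder_ge_Lmin_div (hj1 : 1 ≤ j) (hj : j ≤ 3) :
    IsBoundedUnder (· ≥ ·) atTop fun q : ℝ => Lmin ξ₁ ξ₂ j q / q :=
  ⟨-2, neg_two_le_Lmin_div hj1 hj⟩

lemma phiLow_le_phiUp (hj1 : 1 ≤ j) (hj : j ≤ 3) : phiLow ξ₁ ξ₂ j ≤ phiUp ξ₁ ξ₂ j :=
  liminf_le_limsup (isBoundedUnder_le_Lmin_div hj1 hj) (isBoundedUnder_ge_Lmin_div hj1 hj)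

lemma phiUp_le_one (hj1 : 1 ≤ j) (hj : j ≤ 3) : phiUp ξ₁ ξ₂ j ≤ 1 :=
  limsup_le_of_le (isBoundedUnder_ge_Lmin_div hj1 hj).isCoboundedUnder_le (Lmin_div_le_one hj1 hj)

lemma neg_two_le_phiLow (hj1 : 1 ≤ j) (hj : j ≤ 3) : -2 ≤ phiLow ξ₁ ξ₂ j :=
  le_liminf_of_le (isBoundedUnder_le_Lmin_div hj1 hj).isCoboundedUnder_ge
    (neg_two_le_Lmin_div hj1 hj)

lemma eventually_const_div_lt (C : ℝ) {ε : ℝ} (hε : 0 < ε) : ∀ᶠ q : ℝ in atTop, C / q < ε :=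
  (tendsto_const_nhds.div_atTop tendsto_id).eventually_lt_const hε

lemma phiUp_le (hj1 : 1 ≤ j) (hj : j ≤ 3) (h : ∀ q, 0 < q → Lmin ξ₁ ξ₂ j q ≤ c * q + C) :
    phiUp ξ₁ ξ₂ j ≤ c := by
  refine le_of_forall_pos_le_add fun ε hε => ?_
  refine limsup_le_of_le (isBoundedUnder_ge_Lmin_div hj1 hj).isCoboundedUnder_le ?_
  filter_upwards [eventually_gt_atTop 0, eventually_const_div_lt C hε] with q hq hqε
  rw [div_lt_iff₀ hq] at hqε
  rw [div_le_iff₀ hq]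
  linarith [h q hq]

lemma le_phiLow (hj1 : 1 ≤ j) (hj : j ≤ 3) (h : ∀ q, 0 < q → c * q - C ≤ Lmin ξ₁ ξ₂ j q) :
    c ≤ phiLow ξ₁ ξ₂ j := by
  refine le_of_forall_pos_le_add fun ε hε => ?_
  rw [← sub_le_iff_le_add]
  refine le_liminf_of_le (isBoundedUnder_le_Lmin_div hj1 hj).isCoboundedUnder_ge ?_
  filter_upwards [eventually_gt_atTop 0, eventually_const_div_lt C hε] with q hq hqε
  rw [div_lt_iff₀ hq] at hqε
  rw [le_div_iff₀ hq]
  linarith [h q hq]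

lemma exists_Lmin_le (hj1 : 1 ≤ j) (hj : j ≤ 3) (h : phiUp ξ₁ ξ₂ j < c) :
    ∃ C, ∀ q, 0 < q → Lmin ξ₁ ξ₂ j q ≤ c * q + C := by
  obtain ⟨Q, hQ⟩ := eventually_atTop.1
    (eventually_lt_of_limsup_lt h (isBoundedUnder_le_Lmin_div hj1 hj))
  refine ⟨|Q| * (1 + |c|), fun q hq => ?_⟩
  have hQ0 := abs_nonneg Q
  rcases le_total Q q with hqQ | hqQ
  · have := (div_lt_iff₀ hq).1 (hQ q hqQ)
    have : 0 ≤ |Q| * (1 + |c|) := by positivity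
    linarith
  · have := Lmin_le_self (ξ₁ := ξ₁) (ξ₂ := ξ₂) hj1 hj hq.le
    have h1 : q ≤ |Q| := hqQ.trans (le_abs_self Q)
    nlinarith [neg_abs_le c, abs_nonneg c]

lemma exists_le_Lmin (hj1 : 1 ≤ j) (hj : j ≤ 3) (h : c < phiLow ξ₁ ξ₂ j) :
    ∃ C, ∀ q, 0 < q → c * q - C ≤ Lmin ξ₁ ξ₂ j q := by
  obtain ⟨Q, hQ⟩ := eventually_atTop.1
    (eventually_lt_of_lt_liminf h (isBoundedUnder_ge_Lmin_div hj1 hj))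
  refine ⟨|Q| * (2 + |c|), fun q hq => ?_⟩
  have hQ0 := abs_nonneg Q
  rcases le_total Q q with hqQ | hqQ
  · have := (lt_div_iff₀ hq).1 (hQ q hqQ)
    have : 0 ≤ |Q| * (2 + |c|) := by positivity
    linarith
  · have := neg_two_mul_le_Lmin (ξ₁ := ξ₁) (ξ₂ := ξ₂) hj1 hj hq.le
    have h1 : q ≤ |Q| := hqQ.trans (le_abs_self Q)
    nlinarith [le_abs_self c, abs_nonneg c]

lemma phiUp_one_nonpos : phiUp ξ₁ ξ₂ 1 ≤ 0 :=
  phiUp_le (C := 0) le_rfl (by norm_num) fun q hq => by simpa using Lmin_one_nonpos hq.le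

lemma neg_two_lt_phiUp_one (h : phiLow ξ₁ ξ₂ 3 < 1) : -2 < phiUp ξ₁ ξ₂ 1 := by
  by_contra! hneg
  refine h.not_ge (le_of_forall_pos_le_add fun ε hε => ?_)
  rw [← sub_le_iff_le_add]
  obtain ⟨C, hC⟩ := exists_Lmin_le (c := -2 + 2 * ε) le_rfl (by norm_num)
    (show phiUp ξ₁ ξ₂ 1 < -2 + 2 * ε by linarith)
  refine le_phiLow (C := (C + Real.log 6) / 2) (by norm_num) le_rfl fun q hq => ?_
  linarith [hC q hq, neg_log_le_Lmin_one_add (ξ₁ := ξ₁) (ξ₂ := ξ₂) hq.le]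

lemma max_lt_one_of_isMinimalPoint {t : ℝ} (ht : 0 < t) {x : Fin 3 → ℤ}
    (hx : IsMinimalPoint (latticeMatrix ξ₁ ξ₂) t x) :
    max |embed (latticeMatrix ξ₁ ξ₂) x 1| |embed (latticeMatrix ξ₁ ξ₂) x 2| < 1 := by
  have h := (le_max_right _ _).trans (hx.boxNorm_le_one det_latticeMatrix)
  have h1 := Real.one_lt_exp_iff.2 ht
  by_contra! h2
  nlinarith

lemma one_le_abs_of_isMinimalPoint {t : ℝ} (ht : 0 < t) {x : Fin 3 → ℤ}
    (hx : IsMinimalPoint (latticeMatrix ξ₁ ξ₂) t x) :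
    1 ≤ |embed (latticeMatrix ξ₁ ξ₂) x 0| := by
  have h := max_lt_one_of_isMinimalPoint ht hx
  simp only [embed_latticeMatrix, cons_val, max_lt_iff] at h ⊢
  have h0 : x 0 ≠ 0 := by
    intro h0
    have h1 : |x 1| < 1 := by exact_mod_cast (by simpa [h0] using h.1 : |(x 1 : ℝ)| < 1)
    have h2 : |x 2| < 1 := by exact_mod_cast (by simpa [h0] using h.2 : |(x 2 : ℝ)| < 1)
    rw [Int.abs_lt_one_iff] at h1 h2
    exact hx.1 (funext fun i => by fin_cases i <;> simp [*])
  exact_mod_cast Int.one_le_abs h0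

lemma phiUp_two_le_of_bounds (ha : 0 ≤ a) (ha2 : a < 2) (hb : -1 ≤ b) (hb2 : b ≤ 2)
    (hab : 0 < 2 + a - a * b) (hC : 0 ≤ C)
    (hup : ∀ q, 0 < q → Lmin ξ₁ ξ₂ 1 q ≤ -a * q + C)
    (hlow : ∀ q, 0 < q → -b * q - C ≤ Lmin ξ₁ ξ₂ 1 q) :
    phiUp ξ₁ ξ₂ 2 ≤ (b - a) / (2 + a - a * b) := by
  obtain ⟨C', hC'⟩ := exists_pair_boxNorm_le (D := Set.Ioi 0)
    (det_latticeMatrix (ξ₁ := ξ₁) (ξ₂ := ξ₂)) (by linarith) ha2 hb hb2 hab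
    (fun t ht => mul_nonneg ha (le_of_lt ht))
    (fun t ht x hx => one_pos.trans_le (one_le_abs_of_isMinimalPoint ht hx))
    (fun t ht s _ x hx hs => by
      have hG := max_lt_one_of_isMinimalPoint ht hx
      have hF := one_le_abs_of_isMinimalPoint ht hx
      by_contra! h0
      have h1 : Real.exp s ≤ 1 := Real.exp_le_one_iff.2 (by simpa using h0)
      have h2 : 1 ≤ Real.exp (-2 * s) := Real.one_le_exp (by simp at h0; linarith)
      have h3 := Real.exp_pos s
      nlinarith)
    (fun t _ u _ x _ hx _ _ => by
      rcases lt_or_ge 0 u with hu | hu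
      · exact Lmin_one_eq hu.le hx ▸ hup u hu
      · have := Real.log_nonpos (boxNorm_nonneg _ _) (hx.boxNorm_le_one det_latticeMatrix)
        nlinarith)
    (fun t ht x hx => Lmin_one_eq (le_of_lt ht) hx ▸ hlow t ht)
  refine phiUp_le (C := C') (by norm_num) (by norm_num) fun q hq => ?_
  obtain ⟨y, z, hyz, hy, hz⟩ := hC' q hq
  refine Lmin_le (by norm_num) (by norm_num) hq.le (n := ![y, z]) ?_ ?_
  · convert hyz using 1
    ext i
    fin_cases i <;> rfl
  · intro i
    fin_cases i
    exacts [hy, hz]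

lemma embed_dualMatrix_zero_ne_zero (hind : LinearIndependent ℚ ![(1 : ℝ), ξ₁, ξ₂])
    {m : Fin 3 → ℤ} (hm : m ≠ 0) : embed (dualMatrix ξ₁ ξ₂) m 0 ≠ 0 := by
  intro h
  rw [embed_dualMatrix] at h
  have := Fintype.linearIndependent_iff.1 hind (fun i => (m i : ℚ)) (by
    simpa [Fin.sum_univ_three, Rat.smul_def] using h)
  exact hm (funext fun i => by exact_mod_cast this i)

lemma le_phiLow_two_of_bounds (hind : LinearIndependent ℚ ![(1 : ℝ), ξ₁, ξ₂]) (ha : 0 ≤ a)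
    (ha1 : a ≤ 1) (hb : -2 ≤ b) (hb1 : b ≤ 1) (hab : 0 < 2 - a - b * a)
    (hlow : ∀ q, 0 < q → a * q - C ≤ Lmin ξ₁ ξ₂ 3 q)
    (hup : ∀ q, 0 < q → Lmin ξ₁ ξ₂ 3 q ≤ b * q + C) :
    (a - b) / (2 - a - b * a) ≤ phiLow ξ₁ ξ₂ 2 := by
  have hlog3 : Real.log 3 ≤ Real.log 36 := Real.log_le_log (by norm_num) (by norm_num)
  obtain ⟨C', hC'⟩ := exists_pair_boxNorm_le (D := Set.Iio 0) (a := -a) (b := -b)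
    (C := C + Real.log 36)
    (det_dualMatrix (ξ₁ := ξ₁) (ξ₂ := ξ₂)) (by linarith) (by linarith) (by linarith)
    (by linarith) (by linarith)
    (fun t ht => by
      have : t < 0 := ht
      nlinarith)
    (fun t _ x hx => abs_pos.2 (embed_dualMatrix_zero_ne_zero hind hx.1))
    (fun t ht s hs x _ _ => lt_of_le_of_lt hs ht)
    (fun t ht u hu x y hx hy hxy => by
      have hu0 : 0 < -u := neg_pos.2 (lt_of_le_of_lt hu ht)
      obtain ⟨n, hn, hb⟩ := exists_triple_of_minimal_pair hx hy hxy
      have hpos := hx.pos det_dualMatrix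
      have h1 : Lmin ξ₁ ξ₂ 3 (-u) ≤
          Real.log 36 - Real.log (boxNorm u (embed (dualMatrix ξ₁ ξ₂) x)) := by
        refine Lmin_le (by norm_num) le_rfl hu0.le hn fun i => (hb i).trans_eq ?_
        rw [← Real.log_div (by norm_num) hpos.ne', Real.exp_log (by positivity)]
      linarith [hlow _ hu0])
    (fun t ht x hx => by
      have ht0 : 0 < -t := neg_pos.2 ht
      have hpos := hx.pos det_dualMatrix
      have h1 : -Real.log 3 - Real.log (boxNorm t (embed (dualMatrix ξ₁ ξ₂) x)) ≤
          Lmin ξ₁ ξ₂ 3 (-t) := by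
        refine le_Lmin le_rfl ht0.le fun l hl n hn hb => ?_
        have h := one_le_of_triple (-t) hn hb hx.1
        rw [neg_neg] at h
        have h := Real.log_nonneg h
        rw [Real.log_mul (by norm_num) (by positivity), Real.log_mul hl.ne' hpos.ne'] at h
        linarith
      linarith [hup _ ht0])
  refine le_phiLow (C := C' + Real.log 3) (by norm_num) (by norm_num) fun q hq => ?_
  obtain ⟨y, z, hyz, hy, hz⟩ := hC' (-q) (neg_lt_zero.2 hq)
  have hT : (-b - -a) / (2 + -a - -a * -b) * -q + C' = -((a - b) / (2 - a - b * a) * q - C') := by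
    ring
  rw [hT] at hy hz
  refine le_Lmin (by norm_num) hq.le fun l hl n hn hb => ?_
  have hn' : LinearIndependent ℝ ![embed (latticeMatrix ξ₁ ξ₂) (n 0),
      embed (latticeMatrix ξ₁ ξ₂) (n 1)] := by
    convert hn using 1
    ext i
    fin_cases i <;> rfl
  have h := Real.log_nonneg (one_le_of_pairs q hn' hyz (hb 0) (hb 1) hy hz)
  rw [Real.log_mul (by norm_num) (by positivity), Real.log_mul hl.ne' (by positivity),
    Real.log_exp] at h
  linarith

lemma le_of_forall_perturbation {f : ℝ → ℝ} (hf : ContinuousAt f 0)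
    (h : ∀ ε, 0 < ε → ε < 1 → c ≤ f ε) : c ≤ f 0 := by
  have hf' : Tendsto f (nhdsWithin 0 (Set.Ioi 0)) (nhds (f 0)) :=
    hf.tendsto.mono_left nhdsWithin_le_nhds
  refine ge_of_tendsto hf' ?_
  filter_upwards [Ioo_mem_nhdsGT one_pos] with ε hε using h ε hε.1 hε.2

lemma phiUp_two_le (h : phiLow ξ₁ ξ₂ 3 < 1) :
    phiUp ξ₁ ξ₂ 2 ≤ (phiUp ξ₁ ξ₂ 1 - phiLow ξ₁ ξ₂ 1) /
      (2 - phiUp ξ₁ ξ₂ 1 - phiUp ξ₁ ξ₂ 1 * phiLow ξ₁ ξ₂ 1) := by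
  have hA := neg_two_lt_phiUp_one h
  have hA0 := phiUp_one_nonpos (ξ₁ := ξ₁) (ξ₂ := ξ₂)
  have hB := neg_two_le_phiLow (ξ₁ := ξ₁) (ξ₂ := ξ₂) (le_refl 1) (by norm_num)
  have hBA := phiLow_le_phiUp (ξ₁ := ξ₁) (ξ₂ := ξ₂) (le_refl 1) (by norm_num)
  have hexUp : ∀ c, phiUp ξ₁ ξ₂ 1 < c → _ := fun c => exists_Lmin_le (le_refl 1) (by norm_num)
  have hexLow : ∀ c, c < phiLow ξ₁ ξ₂ 1 → _ := fun c => exists_le_Lmin (le_refl 1) (by norm_num)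
  set A := phiUp ξ₁ ξ₂ 1
  set B := phiLow ξ₁ ξ₂ 1
  have hden : ∀ {a b : ℝ}, 0 ≤ a → a < 2 → b ≤ 2 → 0 < 2 + a - a * b := fun ha ha2 hb => by
    nlinarith
  have hcont : ContinuousAt (fun ε => ((-B + ε * (2 + B)) - -A * (1 - ε)) /
      (2 + -A * (1 - ε) - -A * (1 - ε) * (-B + ε * (2 + B)))) 0 := by
    refine ContinuousAt.div (by fun_prop) (by fun_prop) (ne_of_gt ?_)
    exact hden (by linarith) (by linarith) (by linarith)
  refine (le_of_forall_perturbation hcont fun ε hε hε1 => ?_).trans_eq (by ring_nf)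
  obtain ⟨C₁, hC₁⟩ : ∃ C, ∀ q, 0 < q → Lmin ξ₁ ξ₂ 1 q ≤ -(-A * (1 - ε)) * q + C := by
    rcases hA0.lt_or_eq with hlt | heq
    · exact hexUp _ (by nlinarith)
    · exact ⟨0, fun q hq => by simpa [heq] using Lmin_one_nonpos hq.le⟩
  obtain ⟨C₂, hC₂⟩ : ∃ C, ∀ q, 0 < q → -(-B + ε * (2 + B)) * q - C ≤ Lmin ξ₁ ξ₂ 1 q := by
    rcases hB.lt_or_eq with hlt | heq
    · exact hexLow _ (by nlinarith)
    · exact ⟨0, fun q hq => by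
        simpa [← heq] using
          neg_two_mul_le_Lmin (ξ₁ := ξ₁) (ξ₂ := ξ₂) (le_refl 1) (by norm_num) hq.le⟩
  have ha : 0 ≤ -A * (1 - ε) := mul_nonneg (by linarith) (by linarith)
  have ha2 : -A * (1 - ε) < 2 := by nlinarith
  have hb2 : -B + ε * (2 + B) ≤ 2 := by nlinarith
  refine phiUp_two_le_of_bounds (C := max 0 (max C₁ C₂)) ha ha2 (by nlinarith) hb2
    (hden ha ha2 hb2) (le_max_left _ _) (fun q hq => ?_) (fun q hq => ?_)
  · have : C₁ ≤ max 0 (max C₁ C₂) := by simp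
    linarith [hC₁ q hq]
  · have : C₂ ≤ max 0 (max C₁ C₂) := by simp
    linarith [hC₂ q hq]

lemma le_phiLow_two (hind : LinearIndependent ℚ ![(1 : ℝ), ξ₁, ξ₂])
    (h0 : 0 ≤ phiLow ξ₁ ξ₂ 3) (h1 : phiLow ξ₁ ξ₂ 3 < 1) :
    (phiLow ξ₁ ξ₂ 3 - phiUp ξ₁ ξ₂ 3) /
      (2 - phiLow ξ₁ ξ₂ 3 - phiUp ξ₁ ξ₂ 3 * phiLow ξ₁ ξ₂ 3) ≤ phiLow ξ₁ ξ₂ 2 := by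
  have hB := phiUp_le_one (ξ₁ := ξ₁) (ξ₂ := ξ₂) (by norm_num) (le_refl 3)
  have hAB := phiLow_le_phiUp (ξ₁ := ξ₁) (ξ₂ := ξ₂) (by norm_num) (le_refl 3)
  have hexLow : ∀ c, c < phiLow ξ₁ ξ₂ 3 → _ := fun c => exists_le_Lmin (by norm_num) (le_refl 3)
  have hexUp : ∀ c, phiUp ξ₁ ξ₂ 3 < c → _ := fun c => exists_Lmin_le (by norm_num) (le_refl 3)
  set A := phiLow ξ₁ ξ₂ 3
  set B := phiUp ξ₁ ξ₂ 3
  have hden : ∀ {a b : ℝ}, 0 ≤ a → a < 1 → b ≤ 1 → 0 < 2 - a - b * a := fun ha ha1 hb => by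
    nlinarith
  have hcont : ContinuousAt (fun ε => -((A * (1 - ε) - (B + ε * (1 - B))) /
      (2 - A * (1 - ε) - (B + ε * (1 - B)) * (A * (1 - ε))))) 0 := by
    refine (ContinuousAt.div (by fun_prop) (by fun_prop) (ne_of_gt ?_)).neg
    exact hden (by linarith) (by linarith) (by linarith)
  refine neg_le_neg_iff.1 ((le_of_forall_perturbation hcont fun ε hε hε1 => ?_).trans_eq
    (by ring_nf))
  obtain ⟨C₁, hC₁⟩ : ∃ C, ∀ q, 0 < q → A * (1 - ε) * q - C ≤ Lmin ξ₁ ξ₂ 3 q := by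
    rcases h0.lt_or_eq with hlt | heq
    · exact hexLow _ (by nlinarith)
    · refine ⟨Real.log 6 / 2, fun q hq => ?_⟩
      have := neg_log_le_Lmin_one_add (ξ₁ := ξ₁) (ξ₂ := ξ₂) hq.le
      have := Lmin_one_nonpos (ξ₁ := ξ₁) (ξ₂ := ξ₂) hq.le
      rw [← heq]
      linarith
  obtain ⟨C₂, hC₂⟩ : ∃ C, ∀ q, 0 < q → Lmin ξ₁ ξ₂ 3 q ≤ (B + ε * (1 - B)) * q + C := by
    rcases hB.lt_or_eq with hlt | heq
    · exact hexUp _ (by nlinarith)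
    · exact ⟨0, fun q hq => by
        simpa [heq] using Lmin_le_self (ξ₁ := ξ₁) (ξ₂ := ξ₂) (by norm_num) (le_refl 3) hq.le⟩
  have ha : 0 ≤ A * (1 - ε) := mul_nonneg h0 (by linarith)
  have ha1 : A * (1 - ε) < 1 := by nlinarith
  have hb1 : B + ε * (1 - B) ≤ 1 := by nlinarith
  refine neg_le_neg (le_phiLow_two_of_bounds (C := max C₁ C₂) hind ha ha1.le (by nlinarith) hb1
    (hden ha ha1 hb1) (fun q hq => ?_) (fun q hq => ?_))
  · linarith [hC₁ q hq, le_max_left C₁ C₂]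
  · linarith [hC₂ q hq, le_max_right C₁ C₂]

end

end SchmidtSummerer

/-- Schmidt–Summerer: if `{1, ξ₁, ξ₂}` is linearly independent over `ℚ` and
`0 ≤ φ̲₃ < 1`, then `φ̄₂ ≤ (φ̄₁ - φ̲₁)/(2 - φ̄₁ - φ̄₁·φ̲₁)` and
`φ̲₂ ≥ (φ̲₃ - φ̄₃)/(2 - φ̲₃ - φ̄₃·φ̲₃)`. -/
theorem schmidt_summerer_second_minimum
    (ξ₁ ξ₂ : ℝ) (hind : LinearIndependent ℚ ![(1 : ℝ), ξ₁, ξ₂])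
    (h0 : 0 ≤ phiLow ξ₁ ξ₂ 3) (h1 : phiLow ξ₁ ξ₂ 3 < 1) :
    phiUp ξ₁ ξ₂ 2 ≤
      (phiUp ξ₁ ξ₂ 1 - phiLow ξ₁ ξ₂ 1) /
        (2 - phiUp ξ₁ ξ₂ 1 - phiUp ξ₁ ξ₂ 1 * phiLow ξ₁ ξ₂ 1) ∧
    phiLow ξ₁ ξ₂ 2 ≥
      (phiLow ξ₁ ξ₂ 3 - phiUp ξ₁ ξ₂ 3) /
        (2 - phiLow ξ₁ ξ₂ 3 - phiUp ξ₁ ξ₂ 3 * phiLow ξ₁ ξ₂ 3) := by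
  exact ⟨SchmidtSummerer.phiUp_two_le h1, SchmidtSummerer.le_phiLow_two hind h0 h1⟩
end
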